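/- Assume 2 ≤ m ≤ 26. Let k ≥ 0 be a fixed integer and let Y_{n,k} be the number of fringe subtrees with exactly k keys in the random m-ary search tree 𝒯_n with n keys. Then, as n → ∞, n^{−1/2}(Y_{n,k} − E Y_{n,k}) converges in distribution to N(0, σ_k²), where σ_k² is a constant with σ_k² > 0 except when k = 0 and m = 2. Furthermore, n^{−1/2}(Y_{n,k} − n/((H_m − 1)(k+1)(k+2))) also converges in distribution to N(0, σ_k²). -/

import Mathlib

open scoped BigOperators

namespace MSTpaper

/-- The marked ordered tree underlying an `m`-ary search tree: a node either holds
`j` keys and has no children (`lf j`, with `j ≤ m - 2`; `lf 0` is an external node),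
or is full, holding `m - 1` keys, and has `m` (possibly external) children. -/
inductive MTree (m : ℕ) : Type
  | lf : ℕ → MTree m
  | nd : (Fin m → MTree m) → MTree m

namespace MTree

/-- The number of keys of an `m`-ary search tree. -/
def keys {m : ℕ} : MTree m → ℕ
  | lf j => j
  | nd c => (m - 1) + ∑ i, keys (c i)

end MTree

/-- The `m`-ary search tree built from a list of (distinct) keys: the first `m - 1`
keys go into the root, and each further key is passed to the subtree corresponding to
the interval (among the intervals determined by the root keys) it belongs to. -/
def build (m : ℕ) (l : List ℕ) : MTree m :=
  if h : 2 ≤ m ∧ m - 1 ≤ l.length then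
    MTree.nd (fun i =>
      build m ((l.drop (m - 1)).filter
        (fun x => (l.take (m - 1)).countP (fun p => decide (p < x)) == (i : ℕ))))
  else MTree.lf l.length
termination_by l.length
decreasing_by
  exact lt_of_le_of_lt (List.length_filter_le _ _) (by rw [List.length_drop]; omega)

open Classical in
/-- The number of fringe subtrees of a tree that are isomorphic (as marked ordered
trees, i.e. equal) to the fixed tree `T`. -/
noncomputable def countEq {m : ℕ} (T : MTree m) : MTree m → ℕ
  | MTree.lf j => if MTree.lf j = T then 1 else 0
  | MTree.nd c => (if MTree.nd c = T then 1 else 0) + ∑ i, countEq T (c i)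

open Classical in
/-- The number of fringe subtrees with exactly `k` keys. -/
noncomputable def countKeys {m : ℕ} (k : ℕ) : MTree m → ℕ
  | MTree.lf j => if j = k then 1 else 0
  | MTree.nd c => (if MTree.keys (MTree.nd c) = k then 1 else 0) + ∑ i, countKeys k (c i)

/-- The random `m`-ary search tree with `n` keys, as a function of the permutation
(the order in which the keys `1, …, n` arrive). -/
def mst (m n : ℕ) (π : Equiv.Perm (Fin n)) : MTree m :=
  build m ((List.finRange n).map (fun i => ((π i : ℕ))))

/-- Expectation of a functional of the random `m`-ary search tree, i.e. the average
over the `n!` (uniformly distributed) permutations. -/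
noncomputable def pexp (n : ℕ) (f : Equiv.Perm (Fin n) → ℝ) : ℝ :=
  (∑ π : Equiv.Perm (Fin n), f π) / (Nat.factorial n : ℝ)

/-- The harmonic number `H_m`. -/
noncomputable def Hm (m : ℕ) : ℝ := ∑ i ∈ Finset.range m, (1 : ℝ) / ((i : ℝ) + 1)

open MeasureTheory in
/-- `W_n` converges in distribution, under the uniformly random permutation model,
to the centered normal distribution with variance `v`. -/
def TendstoGauss (W : (n : ℕ) → Equiv.Perm (Fin n) → ℝ) (v : NNReal) : Prop :=
  ∀ f : BoundedContinuousFunction ℝ ℝ,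
    Filter.Tendsto (fun n => pexp n (fun π => f (W n π)))
      Filter.atTop (nhds (∫ x, f x ∂(ProbabilityTheory.gaussianReal 0 v)))

end MSTpaper

namespace MSTpaper

section
open Finset
open scoped BigOperators

theorem build_map_congr {α : Type*} (m : ℕ) (f g : α → ℕ) (N : ℕ) :
    ∀ l : List α, l.length ≤ N → (∀ x ∈ l, ∀ y ∈ l, f x < f y ↔ g x < g y) →
      build m (l.map f) = build m (l.map g) := by
  induction N with
  | zero =>
    intro l hl _
    obtain rfl : l = [] := List.length_eq_zero_iff.1 (Nat.le_zero.1 hl)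
    rfl
  | succ N ih =>
    intro l hl hfg
    rw [build, build]
    simp only [List.length_map]
    split_ifs with h
    · congr 1
      funext i
      rw [← List.map_drop, ← List.map_drop, ← List.map_take, ← List.map_take,
        List.filter_map, List.filter_map]
      have : (l.drop (m - 1)).filter
            ((fun x => ((l.take (m - 1)).map f).countP (fun p => decide (p < x)) == (i : ℕ)) ∘ f)
          = (l.drop (m - 1)).filter
            ((fun x => ((l.take (m - 1)).map g).countP (fun p => decide (p < x)) == (i : ℕ)) ∘ g) := by
        apply List.filter_congr
        intro x hx
        simp only [Function.comp, List.countP_map]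
        congr 1
        apply List.countP_congr
        intro p hp
        simp [hfg p (List.mem_of_mem_take hp) x (List.mem_of_mem_drop hx)]
      rw [this]
      apply ih
      · refine (List.length_filter_le _ _).trans ?_
        rw [List.length_drop]; omega
      · intro x hx y hy
        exact hfg x (List.mem_of_mem_drop (List.mem_of_mem_filter hx))
          y (List.mem_of_mem_drop (List.mem_of_mem_filter hy))
    · rfl

/-- The number of elements of `s` below `x`. -/
def numBelow {n : ℕ} (s : Finset (Fin n)) (x : Fin n) : ℕ := #{p ∈ s | p < x}

/-- The elements outside `s` lying in its `i`-th gap. -/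
def gap {n : ℕ} (s : Finset (Fin n)) (i : ℕ) : Finset (Fin n) :=
  {x | x ∉ s ∧ numBelow s x = i}

theorem mem_gap {n : ℕ} {s : Finset (Fin n)} {i : ℕ} {x : Fin n} :
    x ∈ gap s i ↔ x ∉ s ∧ numBelow s x = i := by simp [gap]

/-- The part of the list `v` beyond its first `r` entries lying in the `i`-th gap of `s`. -/
def gapList {n : ℕ} (s : Finset (Fin n)) (r i : ℕ) (v : List (Fin n)) : List (Fin n) :=
  (v.drop r).filter (fun x => numBelow s x = i)

theorem build_eq_nd {m n : ℕ} (hm : 2 ≤ m) {v : List (Fin n)} (hv : v.Nodup)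
    (hl : m - 1 ≤ v.length) {s : Finset (Fin n)} (hs : (v.take (m - 1)).toFinset = s) :
    build m (v.map (fun x : Fin n => (x : ℕ))) =
      MTree.nd (fun i => build m ((gapList s (m - 1) i v).map (fun x : Fin n => (x : ℕ)))) := by
  subst hs
  rw [build, dif_pos ⟨hm, by simpa using hl⟩]
  congr 1
  funext i
  rw [← List.map_drop, ← List.map_take, List.filter_map, gapList]
  congr 2
  apply List.filter_congr
  intro x hx
  have h1 : ((v.take (m - 1)).map (fun x : Fin n => (x : ℕ))).countP (fun p => decide (p < (x : ℕ)))
      = numBelow (v.take (m - 1)).toFinset x := by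
    have h2 : {p ∈ (v.take (m - 1)).toFinset | p < x} =
        ((v.take (m - 1)).filter (fun p => p < x)).toFinset := by
      ext p; simp
    rw [numBelow, h2, List.toFinset_card_of_nodup
      ((hv.sublist (List.take_sublist _ _)).filter _), List.countP_map, List.countP_eq_length_filter]
    rfl
  simp only [Function.comp]
  rw [h1]
  exact beq_eq_decide _ _

theorem nodup_gapList {n : ℕ} {v : List (Fin n)} (hv : v.Nodup) (s : Finset (Fin n)) (r i : ℕ) :
    (gapList s r i v).Nodup :=
  (hv.sublist (List.drop_sublist _ _)).filter _

theorem mem_gapList {n : ℕ} {v : List (Fin n)} (hv : v.Nodup) (hc : ∀ x, x ∈ v)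
    {s : Finset (Fin n)} {r : ℕ} (hs : (v.take r).toFinset = s) (i : ℕ) (x : Fin n) :
    x ∈ gapList s r i v ↔ x ∈ gap s i := by
  subst hs
  rw [mem_gap, gapList, List.mem_filter]
  have h1 : x ∈ v.take r ∨ x ∈ v.drop r := by
    rw [← List.mem_append, List.take_append_drop]; exact hc x
  have h2 : x ∈ v.take r → x ∉ v.drop r := by
    have := hv
    rw [← List.take_append_drop r v, List.nodup_append] at this
    intro h h'
    exact this.2.2 _ h _ h' rfl
  simp only [decide_eq_true_eq, List.mem_toFinset]
  tauto

theorem gap_unique {n : ℕ} {s : Finset (Fin n)} {i j : ℕ} {x : Fin n} (h : x ∈ gap s i)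
    (h' : x ∈ gap s j) : i = j := by
  rw [mem_gap] at h h'
  exact h.2.symm.trans h'.2

section Glue
variable {m n : ℕ} {s : Finset (Fin n)}

open Classical in
/-- Glue permutations of the gaps of `s` to a self-map fixing the other points. -/
noncomputable def glueFun (σ : ∀ i : Fin m, Equiv.Perm (gap s i)) (x : Fin n) : Fin n :=
  if h : ∃ i : Fin m, x ∈ gap s i then (σ h.choose ⟨x, h.choose_spec⟩ : Fin n) else x

theorem glueFun_of_mem (σ : ∀ i : Fin m, Equiv.Perm (gap s i)) {x : Fin n} {i : Fin m}
    (hx : x ∈ gap s i) : glueFun σ x = σ i ⟨x, hx⟩ := by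
  have h : ∃ i : Fin m, x ∈ gap s i := ⟨i, hx⟩
  rw [glueFun, dif_pos h]
  have key : ∀ (j : Fin m) (hj : x ∈ gap s j), (σ j ⟨x, hj⟩ : Fin n) = σ i ⟨x, hx⟩ := by
    intro j hj
    obtain rfl : j = i := Fin.ext (gap_unique hj hx)
    rfl
  exact key _ _

theorem glueFun_mem_gap (σ : ∀ i : Fin m, Equiv.Perm (gap s i)) {x : Fin n} {i : Fin m}
    (hx : x ∈ gap s i) : glueFun σ x ∈ gap s i := by
  rw [glueFun_of_mem σ hx]; exact (σ i ⟨x, hx⟩).2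

theorem glueFun_injective (σ : ∀ i : Fin m, Equiv.Perm (gap s i)) :
    Function.Injective (glueFun σ) := by
  intro x y hxy
  by_cases hx : ∃ i : Fin m, x ∈ gap s i <;> by_cases hy : ∃ i : Fin m, y ∈ gap s i
  · obtain ⟨i, hi⟩ := hx
    obtain ⟨j, hj⟩ := hy
    obtain rfl : i = j := Fin.ext (gap_unique (hxy ▸ glueFun_mem_gap σ hi) (glueFun_mem_gap σ hj))
    rw [glueFun_of_mem σ hi, glueFun_of_mem σ hj] at hxy
    simpa using (σ i).injective (Subtype.ext hxy)
  · obtain ⟨i, hi⟩ := hx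
    have := glueFun_mem_gap σ hi
    rw [hxy, glueFun, dif_neg hy] at this
    exact absurd ⟨i, this⟩ hy
  · obtain ⟨i, hi⟩ := hy
    have := glueFun_mem_gap σ hi
    rw [← hxy, glueFun, dif_neg hx] at this
    exact absurd ⟨i, this⟩ hx
  · rwa [glueFun, glueFun, dif_neg hx, dif_neg hy] at hxy

/-- The permutation obtained by gluing permutations of the gaps of `s`. -/
noncomputable def glue (σ : ∀ i : Fin m, Equiv.Perm (gap s i)) : Equiv.Perm (Fin n) :=
  Equiv.ofBijective (glueFun σ) (Finite.injective_iff_bijective.1 (glueFun_injective σ))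

theorem glue_apply (σ : ∀ i : Fin m, Equiv.Perm (gap s i)) (x : Fin n) :
    glue σ x = glueFun σ x := rfl

theorem glue_of_mem_base (σ : ∀ i : Fin m, Equiv.Perm (gap s i)) {x : Fin n} (hx : x ∈ s) :
    glue σ x = x := by
  rw [glue_apply, glueFun, dif_neg]
  rintro ⟨i, hi⟩
  exact (mem_gap.1 hi).1 hx

theorem numBelow_glue (σ : ∀ i : Fin m, Equiv.Perm (gap s i)) (x : Fin n) :
    numBelow s (glue σ x) = numBelow s x := by
  by_cases hx : ∃ i : Fin m, x ∈ gap s i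
  · obtain ⟨i, hi⟩ := hx
    rw [(mem_gap.1 hi).2, glue_apply, (mem_gap.1 (glueFun_mem_gap σ hi)).2]
  · rw [glue_apply, glueFun, dif_neg hx]

theorem gapList_glue (σ : ∀ i : Fin m, Equiv.Perm (gap s i)) (r i : ℕ) (v : List (Fin n)) :
    gapList s r i (v.map (glue σ)) = (gapList s r i v).map (glue σ) := by
  rw [gapList, gapList, ← List.map_drop, List.filter_map]
  congr 1
  apply List.filter_congr
  intro x _
  simp only [Function.comp, numBelow_glue]

theorem take_map_glue (σ : ∀ i : Fin m, Equiv.Perm (gap s i)) {r : ℕ} {v : List (Fin n)}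
    (hs : (v.take r).toFinset = s) : (v.map (glue σ)).take r = v.take r := by
  rw [← List.map_take]
  conv_rhs => rw [← List.map_id (v.take r)]
  apply List.map_congr_left
  intro x hx
  exact glue_of_mem_base σ (by rw [← hs]; simpa using hx)

end Glue

/-- A uniformly permuted enumeration of a finite set builds a random search tree. -/
theorem exists_equiv_build_perm (m : ℕ) {n : ℕ} (t : Finset (Fin n)) {w : List (Fin n)}
    (hw : w.Nodup) (hwt : ∀ x, x ∈ w ↔ x ∈ t) :
    ∃ e : Equiv.Perm t ≃ Equiv.Perm (Fin #t), ∀ (σ : Equiv.Perm t) (g : Fin n → Fin n),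
      (∀ x : t, g x = σ x) → build m (w.map (fun x => ((g x : Fin n) : ℕ))) = mst m #t (e σ) := by
  classical
  have hlen : w.length = #t := by
    rw [← List.toFinset_card_of_nodup hw]
    congr 1
    ext x
    simp [hwt]
  let w' : List t := w.pmap Subtype.mk (fun x hx => (hwt x).1 hx)
  have hw'val : w'.map Subtype.val = w := by simp [w', List.map_pmap]
  have hw'n : w'.Nodup := by
    apply List.Nodup.of_map Subtype.val
    rwa [hw'val]
  have hw'len : w'.length = #t := by rw [← hlen, ← hw'val, List.length_map]
  have hw'mem : ∀ x : t, x ∈ w' := by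
    intro x
    have := (hwt x).2 x.2
    rw [← hw'val] at this
    simpa using this
  let e1 : Fin #t ≃ t := (finCongr hw'len.symm).trans (hw'n.getEquivOfForallMemList _ hw'mem)
  let e2 : Fin #t ≃o t := t.orderIsoOfFin rfl
  have hw'e : w' = (List.finRange #t).map e1 := by
    apply List.ext_getElem
    · simp [hw'len]
    · intro i h1 h2
      simp [e1]
  refine ⟨Equiv.equivCongr e1.symm e2.toEquiv.symm, ?_⟩
  intro σ g hg
  have h1 : w.map (fun x => ((g x : Fin n) : ℕ)) =
      (List.finRange #t).map (fun i => ((σ (e1 i) : Fin n) : ℕ)) := by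
    rw [← hw'val, hw'e]
    simp [Function.comp_def, hg]
  rw [h1, mst]
  apply build_map_congr m _ _ _ _ le_rfl
  intro x _ y _
  simp only [Equiv.equivCongr_apply_apply, Equiv.symm_symm, Fin.val_fin_lt]
  rw [Subtype.coe_lt_coe]
  exact (e2.symm.lt_iff_lt).symm

/-- The set of the first `r` values of a permutation. -/
def firstValues {n : ℕ} (r : ℕ) (π : Equiv.Perm (Fin n)) : Finset (Fin n) :=
  (((List.finRange n).map π).take r).toFinset

theorem firstValues_mul {n r : ℕ} (τ π : Equiv.Perm (Fin n)) :
    firstValues r (τ * π) = (firstValues r π).map τ.toEmbedding := by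
  ext x
  simp only [firstValues, ← List.map_take, List.mem_toFinset, List.mem_map, Finset.mem_map]
  constructor
  · rintro ⟨a, ha, rfl⟩
    exact ⟨π a, ⟨a, ha, rfl⟩, rfl⟩
  · rintro ⟨_, ⟨a, ha, rfl⟩, rfl⟩
    exact ⟨a, ha, rfl⟩

theorem card_firstValues {n r : ℕ} (hr : r ≤ n) (π : Equiv.Perm (Fin n)) :
    #(firstValues r π) = r := by
  rw [firstValues, List.toFinset_card_of_nodup]
  · simp [hr]
  · exact (((List.nodup_finRange n).map π.injective)).sublist (List.take_sublist _ _)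

theorem exists_perm_map_eq {n : ℕ} {s t : Finset (Fin n)} (h : #s = #t) :
    ∃ τ : Equiv.Perm (Fin n), s.map τ.toEmbedding = t := by
  classical
  let e : {x // x ∈ s} ≃ {x // x ∈ t} := Finset.equivOfCardEq h
  refine ⟨e.extendSubtype, Finset.eq_of_subset_of_card_le ?_ (by simp [h])⟩
  intro x hx
  obtain ⟨y, hy, rfl⟩ := Finset.mem_map.1 hx
  exact e.extendSubtype_mem y hy

theorem card_fiber_firstValues {n r : ℕ} {s t : Finset (Fin n)} (h : #s = #t) :
    #{π : Equiv.Perm (Fin n) | firstValues r π = s} =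
      #{π : Equiv.Perm (Fin n) | firstValues r π = t} := by
  obtain ⟨τ, hτ⟩ := exists_perm_map_eq h
  apply Finset.card_equiv (Equiv.mulLeft τ)
  intro π
  simp only [Finset.mem_filter, Finset.mem_univ, true_and, Equiv.coe_mulLeft]
  rw [firstValues_mul, ← hτ, Finset.map_inj]

/-- The average of `F` over trees with a full root whose subtrees are independent
random search trees with prescribed numbers of keys. -/
noncomputable def splitAvg {K : Type*} [Field K] [CharZero K] {m : ℕ} (F : MTree m → K)
    (c : Fin m → ℕ) : K :=
  𝔼 ρ : (∀ i : Fin m, Equiv.Perm (Fin (c i))), F (MTree.nd fun i => mst m (c i) (ρ i))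

/-- The vector of gap sizes. -/
def gapSizes {n : ℕ} (m : ℕ) (s : Finset (Fin n)) (i : Fin m) : ℕ := #(gap s i)

section
variable {K : Type*} [Field K] [CharZero K] {m n : ℕ}

theorem expect_glue_mst (hm : 2 ≤ m) (hn : m - 1 ≤ n) (F : MTree m → K)
    (π : Equiv.Perm (Fin n)) {s : Finset (Fin n)} (hs : firstValues (m - 1) π = s) :
    𝔼 σ : (∀ i : Fin m, Equiv.Perm (gap s i)), F (mst m n (glue σ * π)) =
      splitAvg F (gapSizes m s) := by
  have hv : ((List.finRange n).map π).Nodup := (List.nodup_finRange n).map π.injective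
  have hc : ∀ x, x ∈ (List.finRange n).map π := by
    intro x
    rw [List.mem_map]
    exact ⟨π.symm x, List.mem_finRange _, by simp⟩
  choose e he using fun i : Fin m => exists_equiv_build_perm m (gap s i)
    (nodup_gapList hv s (m - 1) i) (mem_gapList hv hc hs i)
  rw [splitAvg]
  refine Fintype.expect_equiv (Equiv.piCongrRight e) _ _ ?_
  intro σ
  congr 1
  have h1 : (List.finRange n).map (fun i => (((glue σ * π) i : Fin n) : ℕ)) =
      (((List.finRange n).map π).map (glue σ)).map (fun x : Fin n => (x : ℕ)) := by
    simp [Function.comp_def]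
  rw [mst, h1, build_eq_nd (s := s) hm (hv.map (glue σ).injective) (by simpa using hn)]
  · congr 1
    funext i
    rw [gapList_glue, List.map_map]
    refine he i (σ i) (glue σ) ?_
    intro x
    rw [glue_apply, glueFun_of_mem σ x.2]
  · rw [take_map_glue σ hs]
    exact hs

theorem expect_fiber_mst (hm : 2 ≤ m) (hn : m - 1 ≤ n) (F : MTree m → K)
    {s : Finset (Fin n)} (hne : ({π | firstValues (m - 1) π = s} : Finset (Equiv.Perm (Fin n))).Nonempty) :
    𝔼 π ∈ ({π | firstValues (m - 1) π = s} : Finset (Equiv.Perm (Fin n))), F (mst m n π) =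
      splitAvg F (gapSizes m s) := by
  have h1 : ∀ σ : (∀ i : Fin m, Equiv.Perm (gap s i)),
      𝔼 π ∈ ({π | firstValues (m - 1) π = s} : Finset (Equiv.Perm (Fin n))), F (mst m n π) =
      𝔼 π ∈ ({π | firstValues (m - 1) π = s} : Finset (Equiv.Perm (Fin n))),
        F (mst m n (glue σ * π)) := by
    intro σ
    symm
    apply Finset.expect_equiv (Equiv.mulLeft (glue σ))
    · intro π
      simp only [Finset.mem_filter, Finset.mem_univ, true_and, Equiv.coe_mulLeft]
      have h2 : s.map (glue σ).toEmbedding = s := by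
        refine Finset.eq_of_subset_of_card_le ?_ (by simp)
        intro x hx
        obtain ⟨y, hy, rfl⟩ := Finset.mem_map.1 hx
        simpa [glue_of_mem_base σ hy] using hy
      rw [firstValues_mul]
      exact ⟨fun h => by rw [h, h2], fun h => Finset.map_injective (glue σ).toEmbedding (by rw [h, h2])⟩
    · intro π _
      rfl
  rw [← Fintype.expect_const (ι := ∀ i : Fin m, Equiv.Perm (gap s i))
    (𝔼 π ∈ ({π | firstValues (m - 1) π = s} : Finset (Equiv.Perm (Fin n))), F (mst m n π)),
    Finset.expect_congr rfl (fun σ _ => h1 σ), Finset.expect_comm,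
    Finset.expect_congr rfl (fun π hπ => expect_glue_mst hm hn F π (Finset.mem_filter.1 hπ).2),
    Finset.expect_const hne]

theorem gapSizes_injOn (hm : 2 ≤ m) :
    Set.InjOn (gapSizes (n := n) m) (powersetCard (m - 1) (univ : Finset (Fin n))) := by
  intro s hs t ht hst
  simp only [Finset.mem_coe, Finset.mem_powersetCard] at hs ht
  have key : ∀ s t : Finset (Fin n), #s = m - 1 → gapSizes m s = gapSizes m t → ∀ x : Fin n,
      (∀ y, y < x → (y ∈ s ↔ y ∈ t)) → x ∈ s → x ∈ t := by
    intro s t hs hst x hx hxs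
    by_contra hxt
    have hb : ∀ y, y ≤ x → numBelow s y = numBelow t y := by
      intro y hy
      rw [numBelow, numBelow]
      congr 1
      ext p
      simp only [Finset.mem_filter]
      constructor
      · rintro ⟨h1, h2⟩
        exact ⟨(hx p (h2.trans_le hy)).1 h1, h2⟩
      · rintro ⟨h1, h2⟩
        exact ⟨(hx p (h2.trans_le hy)).2 h1, h2⟩
    have hlt : numBelow s x < m := by
      have : numBelow s x ≤ #s := Finset.card_filter_le _ _
      omega
    have hmono : ∀ y, x < y → numBelow s x < numBelow s y := by
      intro y hy
      apply Finset.card_lt_card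
      refine ⟨fun p hp => ?_, fun h => ?_⟩
      · simp only [Finset.mem_filter] at hp ⊢
        exact ⟨hp.1, hp.2.trans hy⟩
      · have := h (Finset.mem_filter.2 ⟨hxs, hy⟩)
        exact absurd (Finset.mem_filter.1 this).2 (lt_irrefl x)
    have hss : gap s (numBelow s x) ⊂ gap t (numBelow s x) := by
      rw [Finset.ssubset_iff_of_subset]
      · exact ⟨x, mem_gap.2 ⟨hxt, (hb x le_rfl).symm⟩, fun h => (mem_gap.1 h).1 hxs⟩
      · intro y hy
        rw [mem_gap] at hy ⊢
        have hyx : y < x := by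
          rcases lt_trichotomy y x with h | h | h
          · exact h
          · exact absurd hxs (h ▸ hy.1)
          · exact absurd hy.2 (hmono y h).ne'
        exact ⟨fun h => hy.1 ((hx y hyx).2 h), by rw [← hb y hyx.le, hy.2]⟩
    have := congrFun hst ⟨_, hlt⟩
    exact (Finset.card_lt_card hss).ne this
  ext x
  induction x using WellFoundedLT.induction with
  | ind x ih =>
    exact ⟨key s t hs.2 hst x ih, key t s ht.2 hst.symm x (fun y hy => (ih y hy).symm)⟩

theorem sum_gapSizes (hm : 2 ≤ m) {s : Finset (Fin n)} (hs : #s = m - 1) :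
    ∑ i, gapSizes m s i = n - (m - 1) := by
  have h1 : ∑ i : Fin m, gapSizes m s i = #((univ : Finset (Fin m)).biUnion fun i => gap s i) := by
    rw [Finset.card_biUnion]
    · rfl
    · intro i _ j _ hij
      refine Finset.disjoint_left.2 ?_
      intro x hx hx'
      exact hij (Fin.ext (gap_unique hx hx'))
  have h2 : ((univ : Finset (Fin m)).biUnion fun i => gap s i) = sᶜ := by
    ext x
    simp only [Finset.mem_biUnion, Finset.mem_univ, true_and, mem_gap, Finset.mem_compl]
    constructor
    · rintro ⟨i, hi⟩; exact hi.1
    · intro hx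
      have : numBelow s x ≤ #s := Finset.card_filter_le _ _
      exact ⟨⟨numBelow s x, by omega⟩, hx, rfl⟩
  rw [h1, h2, Finset.card_compl, hs, Fintype.card_fin]

/-- The possible vectors of subtree sizes of a tree with `n` keys. -/
def comps (m n : ℕ) : Finset (Fin m → ℕ) := piAntidiag univ (n - (m - 1))

theorem mem_comps {c : Fin m → ℕ} : c ∈ comps m n ↔ ∑ i, c i = n - (m - 1) := by
  simp [comps]

theorem card_comps (hm : 2 ≤ m) (hn : m - 1 ≤ n) : #(comps m n) = n.choose (m - 1) := by
  have h1 : #(comps m n) = #((univ : Finset (Fin m)).finsuppAntidiag (n - (m - 1))) := by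
    symm
    apply Finset.card_equiv (Finsupp.equivFunOnFinite)
    intro f
    simp [comps, mem_finsuppAntidiag]
  rw [h1, card_finsuppAntidiag_nat_eq_choose, Finset.card_univ, Fintype.card_fin,
    show m + (n - (m - 1)) - 1 = n by omega, Nat.choose_symm hn]

theorem comps_nonempty (hm : 2 ≤ m) (hn : m - 1 ≤ n) : (comps m n).Nonempty := by
  rw [← Finset.card_pos, card_comps hm hn]
  exact Nat.choose_pos hn

/-- Recursive description of the law of the random `m`-ary search tree. -/
theorem expect_mst (hm : 2 ≤ m) (hn : m - 1 ≤ n) (F : MTree m → K) :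
    𝔼 π : Equiv.Perm (Fin n), F (mst m n π) = 𝔼 c ∈ comps m n, splitAvg F c := by
  have hfib : ∀ s ∈ powersetCard (m - 1) (univ : Finset (Fin n)),
      ({π | firstValues (m - 1) π = s} : Finset (Equiv.Perm (Fin n))).Nonempty := by
    intro s hs
    rw [Finset.mem_powersetCard] at hs
    rw [← Finset.card_pos, card_fiber_firstValues (t := firstValues (m - 1) 1)
      (by rw [hs.2, card_firstValues hn]), Finset.card_pos]
    exact ⟨1, by simp⟩
  have h1 : 𝔼 π : Equiv.Perm (Fin n), F (mst m n π) =
      𝔼 s ∈ powersetCard (m - 1) (univ : Finset (Fin n)), splitAvg F (gapSizes m s) := by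
    set N := #{π : Equiv.Perm (Fin n) | firstValues (m - 1) π = firstValues (m - 1) 1} with hN
    have hmaps : ∀ π ∈ (univ : Finset (Equiv.Perm (Fin n))),
        firstValues (m - 1) π ∈ powersetCard (m - 1) (univ : Finset (Fin n)) := by
      intro π _
      rw [Finset.mem_powersetCard]
      exact ⟨Finset.subset_univ _, card_firstValues hn π⟩
    have hNs : ∀ s ∈ powersetCard (m - 1) (univ : Finset (Fin n)),
        #{π : Equiv.Perm (Fin n) | firstValues (m - 1) π = s} = N := by
      intro s hs
      rw [Finset.mem_powersetCard] at hs
      exact card_fiber_firstValues (by rw [hs.2, card_firstValues hn])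
    have hcard : #(univ : Finset (Equiv.Perm (Fin n))) =
        #(powersetCard (m - 1) (univ : Finset (Fin n))) * N := by
      rw [Finset.card_eq_sum_card_fiberwise hmaps, Finset.sum_congr rfl hNs, Finset.sum_const,
        smul_eq_mul]
    have hNpos : N ≠ 0 := (Finset.card_pos.2 ⟨1, by simp⟩).ne'
    rw [Finset.expect_eq_sum_div_card, Finset.expect_eq_sum_div_card, hcard,
      ← Finset.sum_fiberwise_of_maps_to hmaps]
    have : ∀ s ∈ powersetCard (m - 1) (univ : Finset (Fin n)),
        ∑ π : Equiv.Perm (Fin n) with firstValues (m - 1) π = s, F (mst m n π) =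
          N * splitAvg F (gapSizes m s) := by
      intro s hs
      rw [← expect_fiber_mst hm hn F (hfib s hs), ← hNs s hs, Finset.card_mul_expect]
    rw [Finset.sum_congr rfl this, ← Finset.mul_sum]
    push_cast
    have : (N : K) ≠ 0 := by exact_mod_cast hNpos
    rw [mul_comm, mul_div_mul_right _ _ this]
  rw [h1]
  have hinj := gapSizes_injOn (n := n) hm
  have hmap : ∀ s ∈ powersetCard (m - 1) (univ : Finset (Fin n)), gapSizes m s ∈ comps m n := by
    intro s hs
    rw [mem_comps]
    exact sum_gapSizes hm (Finset.mem_powersetCard.1 hs).2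
  refine Finset.expect_nbij (gapSizes m) hmap (fun _ _ => rfl) hinj ?_
  apply Finset.surjOn_of_injOn_of_card_le _ hmap hinj
  rw [card_comps hm hn, Finset.card_powersetCard, Finset.card_univ, Fintype.card_fin]

end

section
variable {K : Type*} [Field K] {m n : ℕ}

/-- The expected sum of `f` over the sizes of the subtrees of the root (zero for trees whose
root has no children). -/
noncomputable def splitOp [CharZero K] (m : ℕ) (f : ℕ → K) (n : ℕ) : K :=
  if m - 1 ≤ n then 𝔼 c ∈ comps m n, ∑ i, f (c i) else 0

theorem sum_comps_eq_coeff (f : ℕ → K) (i : Fin m) :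
    ∑ c ∈ comps m n, f (c i) = PowerSeries.coeff (n - (m - 1))
      (PowerSeries.mk f * PowerSeries.mk 1 ^ (m - 1)) := by
  have h1 : (PowerSeries.mk f * PowerSeries.mk 1 ^ (m - 1) : PowerSeries K) =
      ∏ j : Fin m, if j = i then PowerSeries.mk f else PowerSeries.mk 1 := by
    rw [← Finset.mul_prod_erase univ _ (Finset.mem_univ i), if_pos rfl,
      Finset.prod_congr rfl (fun j hj => if_neg (Finset.ne_of_mem_erase hj)), Finset.prod_const,
      Finset.card_erase_of_mem (Finset.mem_univ i), Finset.card_univ, Fintype.card_fin]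
  rw [h1, PowerSeries.coeff_prod]
  symm
  apply Finset.sum_equiv Finsupp.equivFunOnFinite
  · intro l
    simp [comps, mem_finsuppAntidiag]
  · intro l _
    rw [← Finset.mul_prod_erase univ _ (Finset.mem_univ i), if_pos rfl,
      Finset.prod_congr rfl (g := fun _ => 1), Finset.prod_const_one, mul_one, PowerSeries.coeff_mk]
    · rfl
    · intro j hj
      rw [if_neg (Finset.ne_of_mem_erase hj), PowerSeries.coeff_mk]
      rfl

theorem choose_mul_splitOp [CharZero K] (hm : 2 ≤ m) (hn : m - 1 ≤ n) (f : ℕ → K) :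
    (n.choose (m - 1) : K) * splitOp m f n = m * PowerSeries.coeff (n - (m - 1))
      (PowerSeries.mk f * PowerSeries.mk 1 ^ (m - 1)) := by
  rw [splitOp, if_pos hn, ← card_comps hm hn, Finset.card_mul_expect, Finset.sum_comm,
    Finset.sum_congr rfl (fun i _ => sum_comps_eq_coeff f i), Finset.sum_const, Finset.card_univ,
    Fintype.card_fin, nsmul_eq_mul]

theorem splitOp_eq_zero [CharZero K] (hn : n < m - 1) (f : ℕ → K) : splitOp m f n = 0 := by
  rw [splitOp, if_neg (by omega)]

/-- The Euler operator `(1 - X) d/dX` on formal power series. -/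
noncomputable def eulerOp (K : Type*) [Field K] : Module.End K (PowerSeries K) :=
  LinearMap.mulLeft K (1 - PowerSeries.X) ∘ₗ (PowerSeries.derivative K : PowerSeries K →ₗ[K] PowerSeries K)

theorem eulerOp_apply (g : PowerSeries K) :
    eulerOp K g = (1 - PowerSeries.X) * PowerSeries.derivative K g := rfl

theorem coeff_eulerOp (g : PowerSeries K) (n : ℕ) :
    PowerSeries.coeff n (eulerOp K g) =
      (n + 1) * PowerSeries.coeff (n + 1) g - n * PowerSeries.coeff n g := by
  rw [eulerOp_apply, sub_mul, one_mul, map_sub, PowerSeries.coeff_derivative]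
  rcases n with _ | n
  · simp
  · rw [PowerSeries.coeff_succ_X_mul, PowerSeries.coeff_derivative]
    push_cast
    ring

theorem aeval_eulerOp_ascPochhammer (j : ℕ) (g : PowerSeries K) :
    Polynomial.aeval (eulerOp K) (ascPochhammer K j) g =
      (1 - PowerSeries.X) ^ j * (PowerSeries.derivative K)^[j] g := by
  induction j generalizing g with
  | zero => simp
  | succ j ih =>
    rw [ascPochhammer_succ_right, mul_comm, map_mul, Module.End.mul_apply, ih, map_add,
      Polynomial.aeval_X, map_natCast, LinearMap.add_apply, eulerOp_apply, Derivation.leibniz,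
      Derivation.leibniz_pow, Function.iterate_succ_apply', map_sub, Derivation.map_one_eq_zero,
      PowerSeries.derivative_X, Module.End.natCast_apply]
    simp only [smul_eq_mul, nsmul_eq_mul]
    rcases j with _ | j
    · simp
    · rw [Nat.add_sub_cancel]
      ring

theorem aeval_eulerOp_splitOp [CharZero K] (hm : 2 ≤ m) (f : ℕ → K) :
    Polynomial.aeval (eulerOp K) (ascPochhammer K (m - 1)) (PowerSeries.mk (splitOp m f)) =
      (m.factorial : K) • PowerSeries.mk f := by
  have h1 : (PowerSeries.derivative K)^[m - 1] (PowerSeries.mk (splitOp m f)) =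
      (m.factorial : K) • (PowerSeries.mk f * PowerSeries.mk 1 ^ (m - 1)) := by
    ext j
    rw [PowerSeries.coeff_iterate_derivative, PowerSeries.coeff_mk, PowerSeries.coeff_smul]
    have h2 := choose_mul_splitOp hm (n := j + (m - 1)) (by omega) f
    rw [Nat.add_sub_cancel] at h2
    rw [Nat.ascFactorial_eq_factorial_mul_choose]
    obtain ⟨r, rfl⟩ : ∃ r, m = r + 1 := ⟨m - 1, by omega⟩
    rw [Nat.add_sub_cancel] at h2 ⊢
    push_cast [Nat.factorial_succ] at h2 ⊢
    rw [mul_assoc, h2, smul_eq_mul]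
    ring
  rw [aeval_eulerOp_ascPochhammer, h1, mul_smul_comm]
  congr 1
  rw [mul_comm, mul_assoc, ← mul_pow, PowerSeries.mk_one_mul_one_sub_eq_one, one_pow, mul_one]

end

/-- The coefficients of the power series are `O((n + 1) ^ γ)`. -/
def CoeffBdd (γ : ℝ) (g : PowerSeries ℂ) : Prop :=
  ∃ C : ℝ, ∀ n : ℕ, ‖PowerSeries.coeff n g‖ ≤ C * ((n : ℝ) + 1) ^ γ

theorem rpow_add_two_ge {γ : ℝ} (h0 : 0 < γ) (h1 : γ ≤ 1) (n : ℕ) :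
    ((n : ℝ) + 1) ^ γ * (1 + γ / (n + 2)) ≤ ((n : ℝ) + 2) ^ γ := by
  have hn : (0 : ℝ) ≤ n := Nat.cast_nonneg n
  have hb := rpow_one_add_le_one_add_mul_self (s := -(1 / ((n : ℝ) + 2))) (p := γ)
    (by
      have : 1 / ((n : ℝ) + 2) ≤ 1 := by rw [div_le_one (by positivity)]; linarith
      linarith) h0.le h1
  have h2 : (1 : ℝ) + -(1 / ((n : ℝ) + 2)) = (n + 1) / (n + 2) := by field_simp; ring
  rw [h2, Real.div_rpow (by positivity) (by positivity), div_le_iff₀ (by positivity)] at hb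
  have h3 : (0 : ℝ) ≤ 1 + γ / (n + 2) := by positivity
  calc ((n : ℝ) + 1) ^ γ * (1 + γ / (n + 2))
      ≤ ((1 + γ * -(1 / ((n : ℝ) + 2))) * (n + 2) ^ γ) * (1 + γ / (n + 2)) := by gcongr
    _ = (1 - (γ / (n + 2)) ^ 2) * (n + 2) ^ γ := by ring
    _ ≤ 1 * (n + 2) ^ γ := by
        gcongr
        nlinarith [sq_nonneg (γ / ((n : ℝ) + 2))]
    _ = _ := one_mul _

theorem norm_natCast_add_le {z : ℂ} {b : ℝ} (hz : z.re < 1 + b) :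
    ∃ N : ℕ, ∀ n : ℕ, N ≤ n → ‖(n : ℂ) + z‖ ≤ n + 1 + b := by
  obtain ⟨N, hN⟩ := exists_nat_ge (max (z.im ^ 2 / (1 + b - z.re)) (max (-z.re - 1 - b) (-1 - b)))
  refine ⟨N, fun n hn => ?_⟩
  have hnN : (N : ℝ) ≤ n := by exact_mod_cast hn
  have h1 : z.im ^ 2 / (1 + b - z.re) ≤ n := (le_max_left _ _).trans (hN.trans hnN)
  have h2 : -z.re - 1 - b ≤ n := (le_max_left _ _).trans ((le_max_right _ _).trans (hN.trans hnN))
  have h3 : -1 - b ≤ n := (le_max_right _ _).trans ((le_max_right _ _).trans (hN.trans hnN))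
  rw [div_le_iff₀ (by linarith)] at h1
  have h4 : (0 : ℝ) ≤ n + 1 + b := by linarith
  rw [← abs_of_nonneg h4, ← abs_of_nonneg (norm_nonneg ((n : ℂ) + z)), ← sq_le_sq,
    ← Complex.normSq_eq_norm_sq, Complex.normSq_apply]
  simp only [Complex.add_re, Complex.natCast_re, Complex.add_im, Complex.natCast_im, zero_add]
  nlinarith [mul_nonneg (sub_nonneg.2 hz.le) (by linarith : (0 : ℝ) ≤ n + 1 + b + z.re)]

theorem CoeffBdd.of_eulerOp_sub {γ : ℝ} (h0 : 0 < γ) (h1 : γ ≤ 1) {z : ℂ} (hz : z.re < 1 + γ)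
    {g : PowerSeries ℂ} (hg : CoeffBdd γ (eulerOp ℂ g - z • g)) : CoeffBdd γ g := by
  obtain ⟨C, hC⟩ := hg
  set b := max ((z.re - 1 + γ) / 2) 0 with hb
  have hbγ : b < γ := max_lt (by linarith) h0
  have hb0 : 0 ≤ b := le_max_right _ _
  have hzb : z.re < 1 + b := by
    have := le_max_left ((z.re - 1 + γ) / 2) 0
    rw [← hb] at this
    linarith
  have hC0 : 0 ≤ C := by
    have := (norm_nonneg _).trans (hC 0)
    simpa using this
  obtain ⟨N₁, hN₁⟩ := norm_natCast_add_le hzb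
  obtain ⟨N₂, hN₂⟩ := exists_nat_ge (2 * γ / (γ - b))
  set N := max N₁ N₂ with hN
  set D := 2 * C / (γ - b) + ∑ n ∈ range (N + 1), ‖PowerSeries.coeff n g‖ with hD
  have hD1 : 2 * C / (γ - b) ≤ D := le_add_of_nonneg_right (Finset.sum_nonneg fun _ _ => norm_nonneg _)
  have hD0 : 0 ≤ D := le_trans (div_nonneg (by linarith) (by linarith)) hD1
  have hpow : ∀ n : ℕ, (1 : ℝ) ≤ ((n : ℝ) + 1) ^ γ := fun n =>
    Real.one_le_rpow (by linarith [(Nat.cast_nonneg n : (0 : ℝ) ≤ n)]) h0.le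
  refine ⟨D, fun n => ?_⟩
  induction n with
  | zero =>
    have : ‖PowerSeries.coeff 0 g‖ ≤ ∑ n ∈ range (N + 1), ‖PowerSeries.coeff n g‖ :=
      Finset.single_le_sum (f := fun n => ‖PowerSeries.coeff n g‖) (fun _ _ => norm_nonneg _) (by simp)
    have h' : 0 ≤ 2 * C / (γ - b) := div_nonneg (by linarith) (by linarith)
    simp only [Nat.cast_zero, zero_add, Real.one_rpow, mul_one]
    linarith
  | succ n ih =>
    by_cases hn : n + 1 ≤ N
    · have : ‖PowerSeries.coeff (n + 1) g‖ ≤ ∑ n ∈ range (N + 1), ‖PowerSeries.coeff n g‖ :=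
        Finset.single_le_sum (f := fun n => ‖PowerSeries.coeff n g‖) (fun _ _ => norm_nonneg _)
          (by rw [Finset.mem_range]; omega)
      have h' : 0 ≤ 2 * C / (γ - b) := div_nonneg (by linarith) (by linarith)
      calc ‖PowerSeries.coeff (n + 1) g‖ ≤ D := by linarith
        _ ≤ _ := le_mul_of_one_le_right hD0 (hpow (n + 1))
    · have hnN : N ≤ n := by omega
      have e1 := hC n
      rw [map_sub, coeff_eulerOp, PowerSeries.coeff_smul, smul_eq_mul] at e1
      have e2 := hN₁ n ((le_max_left _ _).trans hnN)
      have e3 : ((n : ℝ) + 1) * ‖PowerSeries.coeff (n + 1) g‖ ≤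
          ‖(n : ℂ) + z‖ * ‖PowerSeries.coeff n g‖ + C * ((n : ℝ) + 1) ^ γ := by
        have : ((n : ℂ) + 1) * PowerSeries.coeff (n + 1) g = ((n : ℂ) + z) * PowerSeries.coeff n g +
          (((n : ℂ) + 1) * PowerSeries.coeff (n + 1) g - n * PowerSeries.coeff n g
            - z * PowerSeries.coeff n g) := by ring
        have h5 : ‖(n : ℂ) + 1‖ = (n : ℝ) + 1 := by
          have := Complex.norm_natCast (n + 1)
          push_cast at this
          exact this
        calc ((n : ℝ) + 1) * ‖PowerSeries.coeff (n + 1) g‖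
            = ‖(n : ℂ) + 1‖ * ‖PowerSeries.coeff (n + 1) g‖ := by rw [h5]
          _ ≤ ‖((n : ℂ) + z) * PowerSeries.coeff n g‖ + C * ((n : ℝ) + 1) ^ γ := by
            rw [← norm_mul, this]
            exact (norm_add_le _ _).trans (by gcongr)
          _ = _ := by rw [norm_mul]
      have e4 : (2 * γ / (γ - b) : ℝ) ≤ n :=
        hN₂.trans (by exact_mod_cast (le_max_right N₁ N₂).trans hnN)
      rw [div_le_iff₀ (by linarith)] at e4
      have hn0 : (0 : ℝ) ≤ n := Nat.cast_nonneg n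
      have e5 : ((n : ℝ) + 1) * ‖PowerSeries.coeff (n + 1) g‖ ≤
          (((n : ℝ) + 1 + b) * D + C) * ((n : ℝ) + 1) ^ γ := by
        calc _ ≤ _ := e3
          _ ≤ ((n : ℝ) + 1 + b) * (D * ((n : ℝ) + 1) ^ γ) + C * ((n : ℝ) + 1) ^ γ := by gcongr
          _ = _ := by ring
      have e6 : ((n : ℝ) + 1 + b) * D + C ≤ (n + 1) * (D * (1 + γ / (n + 2))) := by
        have h6 : C ≤ D * ((γ - b) / 2) := by
          rw [div_le_iff₀ (by linarith)] at hD1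
          linarith
        have h7 : γ / ((n : ℝ) + 2) ≤ (γ - b) / 2 := by
          rw [div_le_iff₀ (by positivity)]
          nlinarith
        have h8 : ((n : ℝ) + 1) * (1 + γ / (n + 2)) = n + 1 + γ - γ / (n + 2) := by
          field_simp; ring
        calc ((n : ℝ) + 1 + b) * D + C ≤ ((n : ℝ) + 1 + b) * D + D * ((γ - b) / 2) := by gcongr
          _ = D * (n + 1 + γ - (γ - b) / 2) := by ring
          _ ≤ D * (n + 1 + γ - γ / (n + 2)) := by gcongr
          _ = _ := by rw [← h8]; ring
      have hn1 : (0 : ℝ) < n + 1 := by linarith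
      rw [← mul_le_mul_iff_right₀ hn1]
      calc _ ≤ _ := e5
        _ ≤ ((n + 1) * (D * (1 + γ / (n + 2)))) * ((n : ℝ) + 1) ^ γ := by gcongr
        _ = (n + 1) * (D * (((n : ℝ) + 1) ^ γ * (1 + γ / (n + 2)))) := by ring
        _ ≤ (n + 1) * (D * ((n : ℝ) + 2) ^ γ) := by
            gcongr
            exact rpow_add_two_ge h0 h1 n
        _ = _ := by
            push_cast
            congr 3
            ring

theorem CoeffBdd.of_aeval_prod {γ : ℝ} (h0 : 0 < γ) (h1 : γ ≤ 1) (S : Multiset ℂ)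
    (hS : ∀ z ∈ S, z.re < 1 + γ) {g : PowerSeries ℂ}
    (hg : CoeffBdd γ (Polynomial.aeval (eulerOp ℂ)
      (S.map fun z => Polynomial.X - Polynomial.C z).prod g)) : CoeffBdd γ g := by
  induction S using Multiset.induction generalizing g with
  | empty => simpa using hg
  | cons z S ih =>
    rw [Multiset.map_cons, Multiset.prod_cons, mul_comm, map_mul, Module.End.mul_apply] at hg
    have h2 := ih (fun w hw => hS w (Multiset.mem_cons_of_mem hw)) hg
    rw [map_sub, Polynomial.aeval_X, Polynomial.aeval_C, LinearMap.sub_apply,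
      Module.algebraMap_end_apply] at h2
    exact CoeffBdd.of_eulerOp_sub h0 h1 (hS z (Multiset.mem_cons_self _ _)) h2

theorem coeff_aeval_prod_eq_zero (S : Multiset ℂ) (d : ℕ) {g : PowerSeries ℂ}
    (hg : ∀ n, n ≤ d + Multiset.card S → PowerSeries.coeff n g = 0) (n : ℕ) (hn : n ≤ d) :
    PowerSeries.coeff n (Polynomial.aeval (eulerOp ℂ)
      (S.map fun z => Polynomial.X - Polynomial.C z).prod g) = 0 := by
  induction S using Multiset.induction generalizing g with
  | empty => simpa using hg n (by simpa using hn)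
  | cons z S ih =>
    rw [Multiset.map_cons, Multiset.prod_cons, mul_comm, map_mul, Module.End.mul_apply]
    apply ih
    intro j hj
    rw [Multiset.card_cons] at hg
    rw [map_sub, Polynomial.aeval_X, Polynomial.aeval_C, LinearMap.sub_apply,
      Module.algebraMap_end_apply, map_sub, coeff_eulerOp, PowerSeries.coeff_smul,
      hg j (by omega), hg (j + 1) (by omega)]
    simp

/-- The power series with coefficients `n + 1`. -/
noncomputable def succSeries : PowerSeries ℂ := PowerSeries.mk fun n => (n : ℂ) + 1

theorem eulerOp_succSeries : eulerOp ℂ succSeries = (2 : ℂ) • succSeries := by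
  ext n
  rw [coeff_eulerOp, PowerSeries.coeff_smul, succSeries, PowerSeries.coeff_mk, PowerSeries.coeff_mk]
  push_cast
  rw [smul_eq_mul]
  ring

theorem aeval_succSeries (Q : Polynomial ℂ) :
    Polynomial.aeval (eulerOp ℂ) Q succSeries = Q.eval 2 • succSeries := by
  induction Q using Polynomial.induction_on' with
  | add p q hp hq => rw [map_add, LinearMap.add_apply, hp, hq, Polynomial.eval_add, add_smul]
  | monomial n a =>
    rw [Polynomial.aeval_monomial, Polynomial.eval_monomial, Module.End.mul_apply,
      Module.algebraMap_end_apply, mul_smul]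
    congr 1
    induction n with
    | zero => simp
    | succ n ih =>
      rw [pow_succ, Module.End.mul_apply, eulerOp_succSeries, map_smul, ih, smul_smul, pow_succ]
      congr 1
      ring

theorem rpow_div_telescope {γ : ℝ} (h0 : 0 ≤ γ) (h1 : γ ≤ 1) (n : ℕ) :
    (1 - γ) * (((n : ℝ) + 1) ^ γ / ((n + 1) * (n + 2))) ≤
      ((n : ℝ) + 1) ^ γ / (n + 1) - ((n : ℝ) + 2) ^ γ / (n + 2) := by
  have hn : (0 : ℝ) ≤ n := Nat.cast_nonneg n
  have hb := rpow_one_add_le_one_add_mul_self (s := 1 / ((n : ℝ) + 1)) (p := γ)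
    (le_trans (by norm_num) (by positivity : (0 : ℝ) ≤ 1 / ((n : ℝ) + 1))) h0 h1
  have h2 : (1 : ℝ) + 1 / ((n : ℝ) + 1) = (n + 2) / (n + 1) := by field_simp; ring
  rw [h2, Real.div_rpow (by positivity) (by positivity), div_le_iff₀ (by positivity)] at hb
  have h3 : ((n : ℝ) + 2) ^ γ / (n + 2) ≤
      ((1 + γ * (1 / ((n : ℝ) + 1))) * ((n : ℝ) + 1) ^ γ) / (n + 2) := by gcongr
  have h4 : (1 - γ) * (((n : ℝ) + 1) ^ γ / ((n + 1) * (n + 2))) =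
      ((n : ℝ) + 1) ^ γ / (n + 1) -
      ((1 + γ * (1 / ((n : ℝ) + 1))) * ((n : ℝ) + 1) ^ γ) / (n + 2) := by
    field_simp
    ring
  linarith

section
variable {γ C : ℝ} {r : ℕ → ℝ}

theorem abs_sum_Ico_le (h0 : 0 ≤ γ) (h1 : γ < 1) (hr : ∀ n : ℕ, |r n| ≤ C * ((n : ℝ) + 1) ^ γ)
    {a b : ℕ} (hab : a ≤ b) :
    ∑ j ∈ Ico a b, |r j / (((j : ℝ) + 1) * (j + 2))| ≤
      C / (1 - γ) * (((a : ℝ) + 1) ^ γ / (a + 1)) := by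
  have hC : 0 ≤ C := by simpa using (abs_nonneg _).trans (hr 0)
  have key : ∑ j ∈ Ico a b, |r j / (((j : ℝ) + 1) * (j + 2))| ≤
      C / (1 - γ) * (((a : ℝ) + 1) ^ γ / (a + 1) - ((b : ℝ) + 1) ^ γ / (b + 1)) := by
    induction b, hab using Nat.le_induction with
    | base => simp
    | succ b hab ih =>
      rw [Finset.sum_Ico_succ_top hab]
      have hb : (0 : ℝ) ≤ b := Nat.cast_nonneg b
      have e1 : |r b / (((b : ℝ) + 1) * (b + 2))| ≤
          C / (1 - γ) * (((b : ℝ) + 1) ^ γ / (b + 1) - ((b : ℝ) + 2) ^ γ / (b + 2)) := by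
        rw [abs_div, abs_of_nonneg (by positivity : (0 : ℝ) ≤ ((b : ℝ) + 1) * (b + 2))]
        calc |r b| / (((b : ℝ) + 1) * (b + 2))
            ≤ (C * ((b : ℝ) + 1) ^ γ) / (((b : ℝ) + 1) * (b + 2)) := by gcongr; exact hr b
          _ = C / (1 - γ) * ((1 - γ) * (((b : ℝ) + 1) ^ γ / (((b : ℝ) + 1) * (b + 2)))) := by
              have : 1 - γ ≠ 0 := by linarith
              field_simp
          _ ≤ _ := mul_le_mul_of_nonneg_left (rpow_div_telescope h0 h1.le b)
              (div_nonneg hC (by linarith))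
      have e2 : ((b + 1 : ℕ) : ℝ) + 1 = b + 2 := by push_cast; ring
      rw [e2]
      linarith
  refine key.trans (mul_le_mul_of_nonneg_left ?_ (div_nonneg hC (by linarith)))
  have : (0 : ℝ) ≤ ((b : ℝ) + 1) ^ γ / (b + 1) := by positivity
  linarith

theorem summable_div_of_le (h0 : 0 ≤ γ) (h1 : γ < 1)
    (hr : ∀ n : ℕ, |r n| ≤ C * ((n : ℝ) + 1) ^ γ) :
    Summable fun j : ℕ => r j / (((j : ℝ) + 1) * (j + 2)) := by
  apply Summable.of_abs
  apply summable_of_sum_range_le (c := C / (1 - γ) * (((0 : ℕ) + 1 : ℝ) ^ γ / ((0 : ℕ) + 1)))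
    (fun _ => abs_nonneg _)
  intro n
  rw [Finset.range_eq_Ico]
  exact abs_sum_Ico_le h0 h1 hr (Nat.zero_le n)

theorem abs_sum_range_sub_tsum_le (h0 : 0 ≤ γ) (h1 : γ < 1)
    (hr : ∀ n : ℕ, |r n| ≤ C * ((n : ℝ) + 1) ^ γ) (n : ℕ) :
    |∑ j ∈ range n, r j / (((j : ℝ) + 1) * (j + 2)) - ∑' j : ℕ, r j / (((j : ℝ) + 1) * (j + 2))| ≤
      C / (1 - γ) * (((n : ℝ) + 1) ^ γ / (n + 1)) := by
  have ht := (summable_div_of_le h0 h1 hr).hasSum.tendsto_sum_nat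
  refine le_of_tendsto (tendsto_const_nhds.sub ht).abs ?_
  filter_upwards [Filter.eventually_ge_atTop n] with N hN
  rw [abs_sub_comm, ← Finset.sum_Ico_eq_sub _ hN]
  exact (Finset.abs_sum_le_sum_abs _ _).trans (abs_sum_Ico_le h0 h1 hr hN)

end

theorem ascPochhammer_eval_two (n : ℕ) :
    (ascPochhammer ℂ n).eval 2 = ((n + 1).factorial : ℂ) := by
  induction n with
  | zero => simp
  | succ n ih =>
    rw [ascPochhammer_succ_eval, ih, Nat.factorial_succ (n + 1)]
    push_cast
    ring

theorem derivative_ascPochhammer_eval_two (n : ℕ) :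
    (Polynomial.derivative (ascPochhammer ℂ n)).eval 2 =
      ((n + 1).factorial : ℂ) * ((Hm (n + 1) - 1 : ℝ) : ℂ) := by
  induction n with
  | zero => simp [Hm]
  | succ n ih =>
    rw [ascPochhammer_succ_right, Polynomial.derivative_mul, Polynomial.eval_add,
      Polynomial.eval_mul, Polynomial.eval_mul, ih, ascPochhammer_eval_two,
      Nat.factorial_succ (n + 1), Hm, Hm, Finset.sum_range_succ _ (n + 1)]
    have : (n : ℂ) + 1 + 1 ≠ 0 := by
      have := Nat.cast_add_one_ne_zero (R := ℂ) (n + 1)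
      push_cast at this
      exact this
    simp
    field_simp
    ring

theorem one_lt_Hm {m : ℕ} (hm : 2 ≤ m) : 1 < Hm m := by
  have h : Hm 2 ≤ Hm m := Finset.sum_le_sum_of_subset_of_nonneg
    (Finset.range_mono hm) (fun _ _ _ => by positivity)
  have : Hm 2 = 3 / 2 := by norm_num [Hm, Finset.sum_range_succ]
  linarith

theorem splitOp_ofReal (m : ℕ) (a : ℕ → ℝ) (n : ℕ) :
    splitOp m (fun n => (a n : ℂ)) n = ((splitOp m a n : ℝ) : ℂ) := by
  unfold splitOp
  split_ifs
  · rw [Complex.ofReal_expect]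
    simp
  · simp

/-- Solutions of the recursion of additive functionals grow linearly, with an error governed by
the roots of the indicial polynomial. -/
theorem abs_sub_linear_le_of_splitOp {m : ℕ} (hm : 2 ≤ m) {γ : ℝ} (h0 : 0 < γ) (h1 : γ < 1)
    (hroots : ∀ z : ℂ, (ascPochhammer ℂ (m - 1)).eval z = (m.factorial : ℂ) → z ≠ 2 →
      z.re < 1 + γ)
    {a r : ℕ → ℝ} (ha : ∀ n, a n = r n + splitOp m a n)
    (hr : ∃ C : ℝ, ∀ n : ℕ, |r n| ≤ C * ((n : ℝ) + 1) ^ γ) :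
    ∃ C : ℝ, ∀ n : ℕ, |a n - (∑' j : ℕ, r j / (((j : ℝ) + 1) * (j + 2))) / (Hm m - 1) * (n + 1)| ≤
      C * ((n : ℝ) + 1) ^ γ := by
  obtain ⟨C, hC⟩ := hr
  set S := ∑' j : ℕ, r j / (((j : ℝ) + 1) * (j + 2)) with hS
  have hm1 : m - 1 + 1 = m := by omega
  set P : Polynomial ℂ := ascPochhammer ℂ (m - 1) - Polynomial.C (m.factorial : ℂ) with hP
  have hdeg : (Polynomial.C (m.factorial : ℂ)).degree < (ascPochhammer ℂ (m - 1)).degree := by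
    apply Polynomial.degree_C_le.trans_lt
    rw [Polynomial.degree_eq_natDegree (monic_ascPochhammer ℂ _).ne_zero, ascPochhammer_natDegree]
    exact_mod_cast (by omega : 0 < m - 1)
  have hPm : P.Monic := (monic_ascPochhammer ℂ (m - 1)).sub_of_left hdeg
  have hPd : P.natDegree = m - 1 := by
    rw [hP, Polynomial.natDegree_sub_C, ascPochhammer_natDegree]
  have hP2 : P.IsRoot 2 := by
    rw [Polynomial.IsRoot, hP, Polynomial.eval_sub, ascPochhammer_eval_two, hm1, Polynomial.eval_C,
      sub_self]
  have hfac := Polynomial.mul_divByMonic_eq_iff_isRoot.2 hP2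
  set Q := P /ₘ (Polynomial.X - Polynomial.C 2) with hQ
  have hQm : Q.Monic := (Polynomial.monic_X_sub_C 2).of_mul_monic_left (hfac ▸ hPm)
  have hQprod := (IsAlgClosed.splits Q).eq_prod_roots_of_monic hQm
  have hQ2 : Q.eval 2 = (m.factorial : ℂ) * ((Hm m - 1 : ℝ) : ℂ) := by
    have h := derivative_ascPochhammer_eval_two (m - 1)
    have h2 : Polynomial.derivative (ascPochhammer ℂ (m - 1)) = Polynomial.derivative P := by
      rw [hP, Polynomial.derivative_sub, Polynomial.derivative_C, sub_zero]
    rw [h2, ← hfac, Polynomial.derivative_mul, hm1] at h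
    simpa using h
  have hH : (0 : ℝ) < Hm m - 1 := by linarith [one_lt_Hm hm]
  have hQ2' : Q.eval 2 ≠ 0 := by
    rw [hQ2]
    exact mul_ne_zero (Nat.cast_ne_zero.2 m.factorial_ne_zero) (Complex.ofReal_ne_zero.2 hH.ne')
  have hcard : Multiset.card Q.roots = m - 2 := by
    rw [← (IsAlgClosed.splits Q).natDegree_eq_card_roots]
    have := congrArg Polynomial.natDegree hfac
    rw [(Polynomial.monic_X_sub_C 2).natDegree_mul hQm, Polynomial.natDegree_X_sub_C, hPd] at this
    omega
  have hre : ∀ z ∈ Q.roots, z.re < 1 + γ := by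
    intro z hz
    have hz' : Q.eval z = 0 := Polynomial.isRoot_of_mem_roots hz
    apply hroots z
    · have : P.eval z = 0 := by rw [← hfac, Polynomial.eval_mul, hz', mul_zero]
      rw [hP, Polynomial.eval_sub, Polynomial.eval_C, sub_eq_zero] at this
      exact this
    · rintro rfl
      exact hQ2' hz'
  set q : PowerSeries ℂ := PowerSeries.mk (splitOp m fun n => (a n : ℂ)) with hq
  have hPq : Polynomial.aeval (eulerOp ℂ) P q =
      (m.factorial : ℂ) • PowerSeries.mk fun n => (r n : ℂ) := by
    have h := aeval_eulerOp_splitOp (K := ℂ) hm fun n => (a n : ℂ)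
    rw [hP, map_sub, Polynomial.aeval_C, LinearMap.sub_apply, Module.algebraMap_end_apply, hq, h,
      ← smul_sub]
    congr 1
    ext n
    rw [map_sub, PowerSeries.coeff_mk, PowerSeries.coeff_mk, PowerSeries.coeff_mk, splitOp_ofReal,
      ha n]
    push_cast
    ring
  set u := Polynomial.aeval (eulerOp ℂ) Q q with hu
  have hu0 : PowerSeries.coeff 0 u = 0 := by
    rw [hu, hQprod]
    refine coeff_aeval_prod_eq_zero _ 0 (fun n hn => ?_) 0 le_rfl
    rw [hq, PowerSeries.coeff_mk, splitOp_eq_zero]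
    omega
  have hurec : ∀ n : ℕ, ((n : ℂ) + 1) * PowerSeries.coeff (n + 1) u =
      (n + 2) * PowerSeries.coeff n u + m.factorial * r n := by
    intro n
    have h := congrArg (PowerSeries.coeff n) hPq
    rw [← hfac, map_mul, Module.End.mul_apply, ← hu, map_sub, Polynomial.aeval_X,
      Polynomial.aeval_C, LinearMap.sub_apply, Module.algebraMap_end_apply, map_sub, coeff_eulerOp,
      PowerSeries.coeff_smul, PowerSeries.coeff_smul, PowerSeries.coeff_mk, smul_eq_mul,
      smul_eq_mul] at h
    linear_combination h
  have hucoeff : ∀ n : ℕ, PowerSeries.coeff n u =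
      (((n + 1) * (m.factorial * ∑ j ∈ range n, r j / (((j : ℝ) + 1) * (j + 2))) : ℝ) : ℂ) := by
    intro n
    induction n with
    | zero => simp [hu0]
    | succ n ih =>
      have hn : (n : ℂ) + 1 ≠ 0 := Nat.cast_add_one_ne_zero n
      have hn2 : (n : ℂ) + 2 ≠ 0 := by exact_mod_cast (by omega : n + 2 ≠ 0)
      apply mul_left_cancel₀ hn
      rw [hurec, ih, Finset.sum_range_succ]
      push_cast
      field_simp
      ring
  have hbdd : CoeffBdd γ (Polynomial.aeval (eulerOp ℂ) Q
      (q - ((S / (Hm m - 1) : ℝ) : ℂ) • succSeries)) := by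
    refine ⟨m.factorial * (C / (1 - γ)), fun n => ?_⟩
    have hn : (0 : ℝ) < (n : ℝ) + 1 := by positivity
    have e : PowerSeries.coeff n (Polynomial.aeval (eulerOp ℂ) Q
        (q - ((S / (Hm m - 1) : ℝ) : ℂ) • succSeries)) = (((n + 1) * (m.factorial *
          (∑ j ∈ range n, r j / (((j : ℝ) + 1) * (j + 2)) - S)) : ℝ) : ℂ) := by
      rw [map_sub, map_smul, aeval_succSeries, map_sub, ← hu, hucoeff, PowerSeries.coeff_smul,
        PowerSeries.coeff_smul, succSeries, PowerSeries.coeff_mk, hQ2]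
      have : ((Hm m : ℝ) : ℂ) - 1 ≠ 0 := by exact_mod_cast hH.ne'
      push_cast
      rw [smul_eq_mul, smul_eq_mul]
      field_simp
    rw [e, Complex.norm_real, Real.norm_eq_abs, abs_mul, abs_mul, abs_of_pos hn, Nat.abs_cast]
    calc _ ≤ ((n : ℝ) + 1) * (m.factorial * (C / (1 - γ) * (((n : ℝ) + 1) ^ γ / (n + 1)))) := by
          gcongr
          exact abs_sum_range_sub_tsum_le h0.le h1 hC n
      _ = _ := by field_simp
  rw [hQprod] at hbdd
  obtain ⟨D, hD⟩ := CoeffBdd.of_aeval_prod h0 h1.le _ hre hbdd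
  refine ⟨C + D, fun n => ?_⟩
  have e := hD n
  rw [map_sub, PowerSeries.coeff_smul, hq, PowerSeries.coeff_mk, succSeries, PowerSeries.coeff_mk,
    splitOp_ofReal, smul_eq_mul] at e
  have e2 : ‖((splitOp m a n - S / (Hm m - 1) * (n + 1) : ℝ) : ℂ)‖ ≤ D * ((n : ℝ) + 1) ^ γ := by
    push_cast at e ⊢
    exact e
  rw [Complex.norm_real, Real.norm_eq_abs] at e2
  rw [ha n, add_sub_assoc, add_mul]
  exact (abs_add_le _ _).trans (add_le_add (hC n) e2)

theorem ascPochhammer_eval_eq_prod {K : Type*} [CommRing K] (n : ℕ) (z : K) :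
    (ascPochhammer K n).eval z = ∏ j ∈ range n, (z + j) := by
  induction n with
  | zero => simp
  | succ n ih => rw [ascPochhammer_succ_eval, ih, Finset.prod_range_succ]

theorem exists_prod_eq_polar {p q : ℕ → ℝ} (hp : ∀ j, 0 < p j) (n : ℕ) :
    ∃ R : ℝ, 0 < R ∧ ∏ j ∈ range n, (⟨p j, q j⟩ : ℂ) =
      ⟨R * Real.cos (∑ j ∈ range n, Real.arctan (q j / p j)),
        R * Real.sin (∑ j ∈ range n, Real.arctan (q j / p j))⟩ := by
  induction n with
  | zero => exact ⟨1, one_pos, by simp [Complex.ext_iff]⟩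
  | succ n ih =>
    obtain ⟨R, hR, h⟩ := ih
    have h1 : (0 : ℝ) < √(1 + (q n / p n) ^ 2) := Real.sqrt_pos.2 (by positivity)
    refine ⟨R * (p n * √(1 + (q n / p n) ^ 2)), by have := hp n; positivity, ?_⟩
    rw [Finset.prod_range_succ, h, Finset.sum_range_succ, Real.cos_add, Real.sin_add,
      Real.sin_arctan, Real.cos_arctan]
    have h2 := (hp n).ne'
    apply Complex.ext
    · rw [Complex.mul_re]
      field_simp
    · rw [Complex.mul_im]
      field_simp
      ring

/-- Exact partial products of the Gaussian integers `(375 + 250 j) + 551 i`. -/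
def gaussProd : ℕ → ℤ × ℤ
  | 0 => (1, 0)
  | j + 1 => ((gaussProd j).1 * (375 + 250 * j) - (gaussProd j).2 * 551,
      (gaussProd j).1 * 551 + (gaussProd j).2 * (375 + 250 * j))

theorem prod_eq_gaussProd (n : ℕ) :
    ∏ j ∈ range n, (⟨375 + 250 * j, 551⟩ : ℂ) = ⟨(gaussProd n).1, (gaussProd n).2⟩ := by
  induction n with
  | zero => simp [gaussProd, Complex.ext_iff]
  | succ n ih =>
    rw [Finset.prod_range_succ, ih]
    apply Complex.ext
    · simp [gaussProd]
    · simp [gaussProd]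

theorem gaussProd_snd_pos : ∀ j ∈ Finset.Icc 3 5, 0 < (gaussProd j).2 := by
  decide +kernel

theorem gaussProd_snd_neg : ∀ j ∈ Finset.Icc 6 25, (gaussProd j).2 < 0 := by
  decide +kernel

theorem sum_arctan_lt {n : ℕ} (hn : n ≤ 25) :
    ∑ j ∈ range n, Real.arctan ((551 : ℝ) / (375 + 250 * j)) < 2 * Real.pi := by
  set Φ : ℕ → ℝ := fun n => ∑ j ∈ range n, Real.arctan ((551 : ℝ) / (375 + 250 * j)) with hΦ
  have hpi := Real.pi_pos
  have hstep : ∀ n, Φ n < Φ (n + 1) ∧ Φ (n + 1) < Φ n + Real.pi / 2 := by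
    intro n
    have h1 : Φ (n + 1) = Φ n + Real.arctan ((551 : ℝ) / (375 + 250 * n)) :=
      Finset.sum_range_succ _ _
    have h2 : 0 < Real.arctan ((551 : ℝ) / (375 + 250 * n)) :=
      Real.arctan_pos.2 (by positivity)
    have h3 := Real.arctan_lt_pi_div_two ((551 : ℝ) / (375 + 250 * n))
    constructor <;> linarith
  have hsin : ∀ n, ∃ R : ℝ, 0 < R ∧ ((gaussProd n).2 : ℝ) = R * Real.sin (Φ n) := by
    intro n
    obtain ⟨R, hR, h⟩ := exists_prod_eq_polar (p := fun j => 375 + 250 * (j : ℝ))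
      (q := fun _ => 551) (fun j => by positivity) n
    rw [prod_eq_gaussProd, Complex.ext_iff] at h
    exact ⟨R, hR, h.2⟩
  have h0 : Φ 0 = 0 := Finset.sum_range_zero _
  have hnn : ∀ n, 0 ≤ Φ n := by
    intro n
    induction n with
    | zero => exact h0.ge
    | succ n ih => exact ih.trans (hstep n).1.le
  have hsmall : ∀ n, n ≤ 5 → Φ n < Real.pi := by
    intro n hn
    induction n with
    | zero => rw [h0]; exact hpi
    | succ n ih =>
      by_cases h2 : n + 1 ≤ 2
      · have a1 := hstep 0
        have a2 := hstep 1
        have hn1 : n ≤ 1 := by omega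
        interval_cases n
        · simp only [zero_add] at *
          linarith
        · simp only [zero_add, Nat.reduceAdd] at *
          linarith
      · obtain ⟨R, hR, h⟩ := hsin (n + 1)
        have hp : (0 : ℝ) < (gaussProd (n + 1)).2 := by
          exact_mod_cast gaussProd_snd_pos (n + 1) (by rw [Finset.mem_Icc]; omega)
        rw [h] at hp
        have hs := pos_of_mul_pos_right hp hR.le
        by_contra! hcon
        have := Real.sin_nonpos_of_nonpos_of_neg_pi_le (x := Φ (n + 1) - 2 * Real.pi)
          (by linarith [(hstep n).2, ih (by omega)]) (by linarith)
        rw [Real.sin_sub_two_pi] at this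
        linarith
  have hbig : ∀ n, n ≤ 25 → Φ n < 2 * Real.pi := by
    intro n hn
    induction n with
    | zero => rw [h0]; linarith
    | succ n ih =>
      by_cases h5 : n + 1 ≤ 5
      · linarith [hsmall _ h5]
      · obtain ⟨R, hR, h⟩ := hsin (n + 1)
        have hp : ((gaussProd (n + 1)).2 : ℝ) < 0 := by
          exact_mod_cast gaussProd_snd_neg (n + 1) (by rw [Finset.mem_Icc]; omega)
        rw [h] at hp
        by_contra! hcon
        have := Real.sin_nonneg_of_nonneg_of_le_pi (x := Φ (n + 1) - 2 * Real.pi)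
          (by linarith) (by linarith [(hstep n).2, ih (by omega)])
        rw [Real.sin_sub_two_pi] at this
        nlinarith
  exact hbig n hn

theorem factorial_sq_lt_prod {m : ℕ} (hm : 2 ≤ m) (hm' : m ≤ 26) :
    (m.factorial : ℝ) ^ 2 < ∏ j ∈ range (m - 1), ((3 / 2 + (j : ℝ)) ^ 2 + (551 / 250) ^ 2) := by
  interval_cases m <;>
    norm_num only [Finset.prod_range_succ, Finset.prod_range_zero, Nat.factorial, Nat.cast_ofNat,
      Nat.cast_zero, Nat.cast_one]

theorem factorial_eq_prod (m : ℕ) (hm : 2 ≤ m) :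
    (m.factorial : ℝ) = ∏ j ∈ range (m - 1), ((2 : ℝ) + j) := by
  obtain ⟨n, rfl⟩ : ∃ n, m = n + 1 := ⟨m - 1, by omega⟩
  rw [Nat.factorial_eq_prod_range_add_one, Finset.prod_range_succ', Nat.add_sub_cancel]
  push_cast
  rw [mul_one]
  exact Finset.prod_congr rfl fun j _ => by ring

theorem re_lt_of_im_nonneg {m : ℕ} (hm : 2 ≤ m) (hm' : m ≤ 26) {z : ℂ}
    (hz : ∏ j ∈ range (m - 1), (z + j) = (m.factorial : ℂ)) (h2 : z ≠ 2) (him : 0 ≤ z.im) :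
    z.re < 3 / 2 := by
  by_contra! hre
  have hne : (range (m - 1)).Nonempty := by rw [Finset.nonempty_range_iff]; omega
  have hzj : ∀ j : ℕ, z + j = ⟨z.re + j, z.im⟩ := fun j => by simp [Complex.ext_iff]
  have hpos : ∀ j : ℕ, 0 < z.re + j := fun j => by
    have : (0 : ℝ) ≤ j := Nat.cast_nonneg j
    linarith
  rcases him.eq_or_lt with h0 | h0
  · have hzr : z = ((z.re : ℝ) : ℂ) := by apply Complex.ext <;> simp [← h0]
    have hz' : ∏ j ∈ range (m - 1), (z.re + j) = (m.factorial : ℝ) := by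
      rw [hzr] at hz
      exact_mod_cast hz
    rw [factorial_eq_prod m hm] at hz'
    rcases lt_trichotomy z.re 2 with h | h | h
    · exact (Finset.prod_lt_prod_of_nonempty (fun j _ => hpos j)
        (fun j _ => by linarith) hne).ne hz'
    · exact h2 (by rw [hzr, h]; norm_num)
    · exact (Finset.prod_lt_prod_of_nonempty (fun j _ => by positivity)
        (fun j _ => by linarith) hne).ne hz'.symm
  · have hT : z.im < 551 / 250 := by
      by_contra! hT
      have h1 := congrArg Complex.normSq hz
      rw [map_prod, Complex.normSq_natCast] at h1
      have h3 := factorial_sq_lt_prod hm hm'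
      rw [sq, ← h1] at h3
      refine absurd h3 (not_lt.2 (Finset.prod_le_prod (fun j _ => by positivity) fun j _ => ?_))
      rw [hzj, Complex.normSq_mk, sq, sq]
      have : (0 : ℝ) ≤ j := Nat.cast_nonneg j
      gcongr
    obtain ⟨R, hR, h⟩ := exists_prod_eq_polar (q := fun _ => z.im) hpos (m - 1)
    rw [← Finset.prod_congr rfl (fun j _ => hzj j), hz, Complex.ext_iff] at h
    set Φ := ∑ j ∈ range (m - 1), Real.arctan (z.im / (z.re + j)) with hΦ
    have hΦ0 : 0 < Φ := Finset.sum_pos (fun j _ => Real.arctan_pos.2 (div_pos h0 (hpos j))) hne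
    have hΦ1 : Φ < 2 * Real.pi := by
      refine lt_of_le_of_lt (Finset.sum_le_sum fun j _ => ?_)
        (sum_arctan_lt (n := m - 1) (by omega))
      apply Real.arctan_strictMono.monotone
      have hj : (0 : ℝ) ≤ j := Nat.cast_nonneg j
      rw [div_le_div_iff₀ (hpos j) (by positivity)]
      nlinarith
    have hc : 0 < Real.cos Φ := by
      have : (0 : ℝ) < m.factorial := Nat.cast_pos.2 m.factorial_pos
      have h1 := h.1
      simp only [Complex.natCast_re] at h1
      rw [h1] at this
      exact pos_of_mul_pos_right this hR.le
    have hs : Real.sin Φ = 0 := by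
      have h1 := h.2
      simp only [Complex.natCast_im] at h1
      exact (mul_eq_zero.1 h1.symm).resolve_left hR.ne'
    have hcos : Real.cos Φ = 1 := by
      nlinarith [Real.sin_sq_add_cos_sq Φ]
    rw [Real.cos_eq_one_iff_of_lt_of_lt (by linarith) hΦ1] at hcos
    exact hΦ0.ne' hcos

/-- For `m ≤ 26`, all roots of the indicial equation other than `2` have real part below `3 / 2`. -/
theorem re_lt_of_ascPochhammer_eval_eq {m : ℕ} (hm : 2 ≤ m) (hm' : m ≤ 26) {z : ℂ}
    (hz : (ascPochhammer ℂ (m - 1)).eval z = (m.factorial : ℂ)) (h2 : z ≠ 2) : z.re < 3 / 2 := by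
  rw [ascPochhammer_eval_eq_prod] at hz
  rcases le_total 0 z.im with h | h
  · exact re_lt_of_im_nonneg hm hm' hz h2 h
  · rw [← Complex.conj_re]
    apply re_lt_of_im_nonneg hm hm'
    · have := congrArg (starRingEnd ℂ) hz
      rw [map_prod] at this
      simpa using this
    · intro h
      apply h2
      have := congrArg (starRingEnd ℂ) h
      rw [Complex.conj_conj, map_ofNat] at this
      exact this
    · rw [Complex.conj_im]
      linarith

theorem exists_root_bound {m : ℕ} (hm : 2 ≤ m) (hm' : m ≤ 26) : ∃ β : ℝ, 0 < β ∧ β < 1 / 2 ∧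
    ∀ z : ℂ, (ascPochhammer ℂ (m - 1)).eval z = (m.factorial : ℂ) → z ≠ 2 → z.re < 1 + β := by
  set P : Polynomial ℂ := ascPochhammer ℂ (m - 1) - Polynomial.C (m.factorial : ℂ) with hP
  have hP0 : P ≠ 0 := by
    intro h
    have : P.natDegree = m - 1 := by
      rw [hP, Polynomial.natDegree_sub_C, ascPochhammer_natDegree]
    rw [h, Polynomial.natDegree_zero] at this
    omega
  set S := P.roots.toFinset.filter (fun z => z ≠ 2) with hS
  have hmem : ∀ z : ℂ, z ∈ S ↔ (ascPochhammer ℂ (m - 1)).eval z = (m.factorial : ℂ) ∧ z ≠ 2 := by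
    intro z
    rw [hS, Finset.mem_filter, Multiset.mem_toFinset, Polynomial.mem_roots hP0, Polynomial.IsRoot,
      hP, Polynomial.eval_sub, Polynomial.eval_C, sub_eq_zero]
  have hT : (insert (1 : ℝ) (S.image Complex.re)).Nonempty := Finset.insert_nonempty _ _
  set M := (insert (1 : ℝ) (S.image Complex.re)).max' hT with hM
  have h1 : 1 ≤ M := Finset.le_max' _ _ (Finset.mem_insert_self _ _)
  have h2 : M < 3 / 2 := by
    rw [hM, Finset.max'_lt_iff]
    intro y hy
    rw [Finset.mem_insert, Finset.mem_image] at hy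
    rcases hy with rfl | ⟨z, hz, rfl⟩
    · norm_num
    · rw [hmem] at hz
      exact re_lt_of_ascPochhammer_eval_eq hm hm' hz.1 hz.2
  refine ⟨(M - 1 + 1 / 2) / 2, by linarith, by linarith, fun z hz hz2 => ?_⟩
  have : z.re ≤ M := Finset.le_max' _ _
    (Finset.mem_insert_of_mem (Finset.mem_image_of_mem _ ((hmem z).2 ⟨hz, hz2⟩)))
  linarith

theorem sum_length_filter_beq (m : ℕ) (g : ℕ → ℕ) (l : List ℕ) (hl : ∀ x ∈ l, g x < m) :
    ∑ i : Fin m, (l.filter (fun x => g x == (i : ℕ))).length = l.length := by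
  induction l with
  | nil => simp
  | cons a l ih =>
    have ih' := ih fun x hx => hl x (List.mem_cons_of_mem _ hx)
    have ha := hl a List.mem_cons_self
    have h1 : ∀ i : Fin m, ((a :: l).filter (fun x => g x == (i : ℕ))).length =
        (if i = ⟨g a, ha⟩ then 1 else 0) + (l.filter (fun x => g x == (i : ℕ))).length := by
      intro i
      rw [List.filter_cons]
      by_cases h : i = ⟨g a, ha⟩
      · subst h
        simp [add_comm]
      · have : ¬ g a = (i : ℕ) := fun h' => h (Fin.ext h'.symm)
        simp [h, this]
    rw [Finset.sum_congr rfl fun i _ => h1 i, Finset.sum_add_distrib, ih']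
    simp [add_comm]

theorem keys_build (m : ℕ) (l : List ℕ) : (build m l).keys = l.length := by
  induction h : l.length using Nat.strong_induction_on generalizing l with
  | _ n ih =>
    rw [build]
    split_ifs with hl
    · rw [MTree.keys]
      have hlt : ∀ i : Fin m, ((l.drop (m - 1)).filter
        (fun x => (l.take (m - 1)).countP (fun p => decide (p < x)) == (i : ℕ))).length < n := by
        intro i
        exact lt_of_le_of_lt (List.length_filter_le _ _) (by rw [List.length_drop]; omega)
      rw [Finset.sum_congr rfl fun i _ => ih _ (hlt i) _ rfl, sum_length_filter_beq m
        (fun x => (l.take (m - 1)).countP (fun p => decide (p < x))), List.length_drop]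
      · omega
      · intro x _
        refine lt_of_le_of_lt List.countP_le_length ?_
        rw [List.length_take]
        omega
    · rw [MTree.keys, h]

theorem keys_mst (m n : ℕ) (π : Equiv.Perm (Fin n)) : (mst m n π).keys = n := by
  rw [mst, keys_build, List.length_map, List.length_finRange]

theorem mst_eq_lf {m n : ℕ} (hn : n < m - 1) (π : Equiv.Perm (Fin n)) :
    mst m n π = MTree.lf n := by
  rw [mst, build, dif_neg (by simp; omega), List.length_map, List.length_finRange]

theorem countKeys_mst_of_lt {m n : ℕ} (k : ℕ) (hn : n < m - 1) (π : Equiv.Perm (Fin n)) :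
    countKeys k (mst m n π) = if n = k then 1 else 0 := by
  rw [mst_eq_lf hn, countKeys]

theorem countKeys_nd {m n : ℕ} (k : ℕ) (hn : m - 1 ≤ n) {c : Fin m → ℕ} (hc : c ∈ comps m n)
    (ρ : ∀ i : Fin m, Equiv.Perm (Fin (c i))) :
    countKeys k (MTree.nd fun i => mst m (c i) (ρ i)) =
      (if n = k then 1 else 0) + ∑ i, countKeys k (mst m (c i) (ρ i)) := by
  rw [countKeys, MTree.keys, Finset.sum_congr rfl fun i _ => keys_mst m (c i) (ρ i),
    mem_comps.1 hc, Nat.add_sub_cancel' hn]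

section Product

theorem expect_pi_fin_succ {K : Type*} [Field K] [CharZero K] {m : ℕ} {α : Fin (m + 1) → Type}
    [∀ i, Fintype (α i)] (g : (∀ i, α i) → K) :
    𝔼 ρ, g ρ = 𝔼 x : α 0, 𝔼 y : (∀ i : Fin m, α i.succ), g (Fin.cons x y) := by
  rw [← Finset.expect_product', Finset.univ_product_univ]
  exact (Fintype.expect_equiv (Fin.consEquiv α) _ _ fun p => rfl).symm

theorem expect_pi_prod {K : Type*} [Field K] [CharZero K] {m : ℕ} {α : Fin m → Type}
    [∀ i, Fintype (α i)] (g : ∀ i, α i → K) :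
    𝔼 ρ : (∀ i, α i), ∏ i, g i (ρ i) = ∏ i, 𝔼 x, g i x := by
  induction m with
  | zero => simp
  | succ m ih =>
    rw [expect_pi_fin_succ, Fin.prod_univ_succ, Finset.expect_mul]
    apply Finset.expect_congr rfl
    intro x _
    rw [← ih, Finset.mul_expect]
    apply Finset.expect_congr rfl
    intro y _
    rw [Fin.prod_univ_succ]
    simp

theorem expect_pi_sum {K : Type*} [Field K] [CharZero K] {m : ℕ} {α : Fin m → Type}
    [∀ i, Fintype (α i)] [∀ i, Nonempty (α i)] (g : ∀ i, α i → K) :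
    𝔼 ρ : (∀ i, α i), ∑ i, g i (ρ i) = ∑ i, 𝔼 x, g i x := by
  induction m with
  | zero => simp
  | succ m ih =>
    rw [expect_pi_fin_succ, Fin.sum_univ_succ, ← ih (fun i => g i.succ)]
    simp only [Fin.sum_univ_succ, Fin.cons_zero, Fin.cons_succ, Finset.expect_add_distrib,
      Fintype.expect_const]

theorem expect_pi_sum_sq {m : ℕ} {α : Fin m → Type} [∀ i, Fintype (α i)] [∀ i, Nonempty (α i)]
    (g : ∀ i, α i → ℝ) (hg : ∀ i, 𝔼 x, g i x = 0) :
    𝔼 ρ : (∀ i, α i), (∑ i, g i (ρ i)) ^ 2 = ∑ i, 𝔼 x, g i x ^ 2 := by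
  induction m with
  | zero => simp
  | succ m ih =>
    rw [expect_pi_fin_succ, Fin.sum_univ_succ, ← ih (fun i => g i.succ) fun i => hg _]
    have h0 : 𝔼 y : (∀ i : Fin m, α i.succ), ∑ i : Fin m, g i.succ (y i) = 0 := by
      rw [expect_pi_sum]
      exact Finset.sum_eq_zero fun i _ => hg _
    simp only [Fin.sum_univ_succ, Fin.cons_zero, Fin.cons_succ, add_sq, Finset.expect_add_distrib,
      Fintype.expect_const, ← Finset.mul_expect, h0]
    simp

theorem expect_pi_sum_pow_four_le {m : ℕ} {α : Fin m → Type} [∀ i, Fintype (α i)]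
    [∀ i, Nonempty (α i)] (g : ∀ i, α i → ℝ) (hg : ∀ i, 𝔼 x, g i x = 0) :
    𝔼 ρ : (∀ i, α i), (∑ i, g i (ρ i)) ^ 4 ≤
      ∑ i, 𝔼 x, g i x ^ 4 + 3 * (∑ i, 𝔼 x, g i x ^ 2) ^ 2 := by
  induction m with
  | zero => simp
  | succ m ih =>
    have ih' := ih (fun i => g i.succ) fun i => hg _
    rw [expect_pi_fin_succ, Fin.sum_univ_succ, Fin.sum_univ_succ]
    have h0 : 𝔼 y : (∀ i : Fin m, α i.succ), ∑ i : Fin m, g i.succ (y i) = 0 := by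
      rw [expect_pi_sum]
      exact Finset.sum_eq_zero fun i _ => hg _
    have h2 := expect_pi_sum_sq (fun i : Fin m => g i.succ) fun i => hg _
    have e : ∀ a b : ℝ, (a + b) ^ 4 = a ^ 4 + (4 * a ^ 3) * b + (6 * a ^ 2) * b ^ 2 +
      (4 * a) * b ^ 3 + b ^ 4 := fun a b => by ring
    have h4 : ∀ T : ℝ, 𝔼 x : α 0, 4 * g 0 x * T = 0 := by
      intro T
      rw [← Finset.expect_mul, ← Finset.mul_expect, hg 0]
      ring
    simp only [Fin.sum_univ_succ, Fin.cons_zero, Fin.cons_succ, e, Finset.expect_add_distrib,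
      Fintype.expect_const, ← Finset.mul_expect, h0, h2, h4]
    simp only [mul_zero, Finset.expect_const_zero, add_zero]
    rw [← Finset.expect_mul, ← Finset.mul_expect]
    have h5 : (0 : ℝ) ≤ 𝔼 x : α 0, g 0 x ^ 2 := Finset.expect_nonneg fun _ _ => sq_nonneg _
    nlinarith

end Product

section
variable {m n k : ℕ}

/-- The number of fringe subtrees with `k` keys, as a real random variable. -/
noncomputable def keyCount (m k n : ℕ) (π : Equiv.Perm (Fin n)) : ℝ := countKeys k (mst m n π)

/-- The indicator of `n = k`. -/
def tollAt (k n : ℕ) : ℝ := if n = k then 1 else 0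

/-- The mean number of fringe subtrees with `k` keys. -/
noncomputable def meanCount (m k n : ℕ) : ℝ := 𝔼 π, keyCount m k n π

/-- The centered `p`-th moment of the number of fringe subtrees with `k` keys. -/
noncomputable def momentCount (p m k n : ℕ) : ℝ := 𝔼 π, (keyCount m k n π - meanCount m k n) ^ p

/-- The conditional bias of the mean given the sizes of the subtrees of the root. -/
noncomputable def splitBias (m k n : ℕ) (c : Fin m → ℕ) : ℝ :=
  ∑ i, meanCount m k (c i) + tollAt k n - meanCount m k n

theorem keyCount_of_lt (hn : n < m - 1) (π : Equiv.Perm (Fin n)) :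
    keyCount m k n π = tollAt k n := by
  rw [keyCount, countKeys_mst_of_lt k hn, tollAt]
  push_cast
  rfl

theorem meanCount_of_lt (hn : n < m - 1) : meanCount m k n = tollAt k n := by
  rw [meanCount, Finset.expect_congr rfl fun π _ => keyCount_of_lt hn π, Fintype.expect_const]

theorem momentCount_of_lt {p : ℕ} (hp : p ≠ 0) (hn : n < m - 1) : momentCount p m k n = 0 := by
  rw [momentCount]
  apply Finset.expect_eq_zero
  intro π _
  rw [keyCount_of_lt hn, meanCount_of_lt hn, sub_self, zero_pow hp]

theorem expect_keyCount {K : Type*} [Field K] [CharZero K] (hm : 2 ≤ m) (hn : m - 1 ≤ n)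
    (G : ℝ → K) : 𝔼 π, G (keyCount m k n π) =
      𝔼 c ∈ comps m n, 𝔼 ρ : (∀ i, Equiv.Perm (Fin (c i))),
        G (∑ i, keyCount m k (c i) (ρ i) + tollAt k n) := by
  have h := expect_mst hm hn fun T => G (countKeys k T)
  unfold keyCount
  rw [h]
  apply Finset.expect_congr rfl
  intro c hc
  rw [splitAvg]
  apply Finset.expect_congr rfl
  intro ρ _
  rw [countKeys_nd k hn hc, tollAt]
  push_cast
  rw [add_comm]

theorem expect_keyCount_sub_mean (i : ℕ) :
    𝔼 π, (keyCount m k i π - meanCount m k i) = 0 := by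
  rw [Finset.expect_sub_distrib, Fintype.expect_const, meanCount, sub_self]

theorem meanCount_rec (hm : 2 ≤ m) (n : ℕ) :
    meanCount m k n = tollAt k n + splitOp m (meanCount m k) n := by
  by_cases hn : m - 1 ≤ n
  · rw [splitOp, if_pos hn]
    have h := expect_keyCount (k := k) hm hn (fun x : ℝ => x)
    rw [meanCount, h, ← Finset.expect_const (comps_nonempty hm hn) (tollAt k n),
      ← Finset.expect_add_distrib]
    apply Finset.expect_congr rfl
    intro c _
    rw [Finset.expect_add_distrib, Fintype.expect_const, expect_pi_sum, add_comm]
    rw [Finset.expect_const (comps_nonempty hm hn)]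
    rfl
  · rw [meanCount_of_lt (by omega), splitOp_eq_zero (by omega), add_zero]

theorem momentCount_rec {p : ℕ} (hm : 2 ≤ m) (hn : m - 1 ≤ n) :
    momentCount p m k n = 𝔼 c ∈ comps m n, 𝔼 ρ : (∀ i, Equiv.Perm (Fin (c i))),
      (∑ i, (keyCount m k (c i) (ρ i) - meanCount m k (c i)) + splitBias m k n c) ^ p := by
  have h := expect_keyCount (k := k) hm hn (fun x : ℝ => (x - meanCount m k n) ^ p)
  rw [momentCount, h]
  apply Finset.expect_congr rfl
  intro c _
  apply Finset.expect_congr rfl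
  intro ρ _
  rw [splitBias, Finset.sum_sub_distrib]
  congr 1
  ring

/-- The toll function of the recursion for the variance. -/
noncomputable def biasSq (m k n : ℕ) : ℝ :=
  if m - 1 ≤ n then 𝔼 c ∈ comps m n, splitBias m k n c ^ 2 else 0

theorem biasSq_nonneg : 0 ≤ biasSq m k n := by
  rw [biasSq]
  split_ifs
  · exact Finset.expect_nonneg fun _ _ => sq_nonneg _
  · exact le_rfl

theorem momentCount_two_rec (hm : 2 ≤ m) (n : ℕ) :
    momentCount 2 m k n = biasSq m k n + splitOp m (momentCount 2 m k) n := by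
  by_cases hn : m - 1 ≤ n
  · rw [splitOp, if_pos hn, biasSq, if_pos hn, momentCount_rec hm hn, ← Finset.expect_add_distrib]
    apply Finset.expect_congr rfl
    intro c _
    have h0 : 𝔼 ρ : (∀ i, Equiv.Perm (Fin (c i))),
        ∑ i, (keyCount m k (c i) (ρ i) - meanCount m k (c i)) = 0 := by
      rw [expect_pi_sum (fun i π => keyCount m k (c i) π - meanCount m k (c i))]
      exact Finset.sum_eq_zero fun i _ => expect_keyCount_sub_mean _
    have h2 := expect_pi_sum_sq (fun i π => keyCount m k (c i) π - meanCount m k (c i))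
      fun i => expect_keyCount_sub_mean _
    simp only [add_sq, Finset.expect_add_distrib, Fintype.expect_const, h2]
    rw [← Finset.expect_mul, ← Finset.mul_expect, h0]
    simp only [momentCount]
    ring
  · rw [momentCount_of_lt two_ne_zero (by omega), splitOp_eq_zero (by omega), biasSq,
      if_neg (by omega), add_zero]

theorem add_pow_four_le (a b : ℝ) : (a + b) ^ 4 ≤ 5 / 4 * a ^ 4 + 4913 * b ^ 4 := by
  have h1 : (a + b) ^ 2 ≤ 17 / 16 * a ^ 2 + 17 * b ^ 2 := by
    nlinarith [sq_nonneg (a - 16 * b)]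
  have h2 : (17 / 16 * a ^ 2 + 17 * b ^ 2) ^ 2 ≤
      17 / 16 * (17 / 16 * a ^ 2) ^ 2 + 17 * (17 * b ^ 2) ^ 2 := by
    nlinarith [sq_nonneg (17 / 16 * a ^ 2 - 16 * (17 * b ^ 2))]
  calc (a + b) ^ 4 = ((a + b) ^ 2) ^ 2 := by ring
    _ ≤ (17 / 16 * a ^ 2 + 17 * b ^ 2) ^ 2 := by gcongr
    _ ≤ _ := h2
    _ ≤ 5 / 4 * a ^ 4 + 4913 * b ^ 4 := by nlinarith [sq_nonneg (a ^ 2)]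

theorem lt_of_mem_comps (hm : 2 ≤ m) (hn : m - 1 ≤ n) {c : Fin m → ℕ} (hc : c ∈ comps m n)
    (i : Fin m) : c i < n := by
  have h1 : c i ≤ ∑ j, c j := Finset.single_le_sum (fun _ _ => Nat.zero_le _) (Finset.mem_univ i)
  rw [mem_comps.1 hc] at h1
  omega

theorem sum_succ_of_mem_comps (hm : 2 ≤ m) (hn : m - 1 ≤ n) {c : Fin m → ℕ}
    (hc : c ∈ comps m n) : ∑ i, ((c i : ℝ) + 1) = n + 1 := by
  have h : ∑ i, (c i + 1) = n + 1 := by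
    rw [Finset.sum_add_distrib, mem_comps.1 hc]
    simp
    omega
  exact_mod_cast h

theorem splitOp_mono {f g : ℕ → ℝ} (hm : 2 ≤ m) (h : ∀ j < n, f j ≤ g j) :
    splitOp m f n ≤ splitOp m g n := by
  unfold splitOp
  split_ifs with hn
  · exact Finset.expect_le_expect fun c hc =>
      Finset.sum_le_sum fun i _ => h _ (lt_of_mem_comps hm hn hc i)
  · exact le_rfl

theorem splitOp_succ (hm : 2 ≤ m) (hn : m - 1 ≤ n) :
    splitOp m (fun j => (j : ℝ) + 1) n = n + 1 := by
  rw [splitOp, if_pos hn, Finset.expect_congr rfl fun c hc => sum_succ_of_mem_comps hm hn hc,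
    Finset.expect_const (comps_nonempty hm hn)]

theorem splitOp_const (hm : 2 ≤ m) (hn : m - 1 ≤ n) (a : ℝ) :
    splitOp m (fun _ => a) n = m * a := by
  simp only [splitOp, if_pos hn, Finset.sum_const, Finset.card_univ, Fintype.card_fin,
    nsmul_eq_mul, Finset.expect_const (comps_nonempty hm hn)]

theorem splitOp_add (f g : ℕ → ℝ) :
    splitOp m (fun j => f j + g j) n = splitOp m f n + splitOp m g n := by
  unfold splitOp
  split_ifs
  · simp only [Finset.sum_add_distrib, Finset.expect_add_distrib]
  · rw [add_zero]

theorem splitOp_const_mul (a : ℝ) (f : ℕ → ℝ) :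
    splitOp m (fun j => a * f j) n = a * splitOp m f n := by
  unfold splitOp
  split_ifs
  · simp only [← Finset.mul_sum, ← Finset.mul_expect]
  · rw [mul_zero]

theorem splitOp_succ_mul_succ (hm : 2 ≤ m) (hn : m - 1 ≤ n) :
    splitOp m (fun j => ((j : ℝ) + 1) * (j + 2)) n = 2 / (m + 1) * ((n + 1) * (n + 2)) := by
  have h := choose_mul_splitOp hm hn fun j => ((j : ℝ) + 1) * (j + 2)
  have h1 : (PowerSeries.mk fun j : ℕ => ((j : ℝ) + 1) * (j + 2)) =
      (2 : ℝ) • (PowerSeries.mk 1 : PowerSeries ℝ) ^ 3 := by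
    ext j
    rw [PowerSeries.coeff_smul, PowerSeries.mk_one_pow_eq_mk_choose_add, PowerSeries.coeff_mk,
      PowerSeries.coeff_mk, add_comm 2 j, Nat.cast_choose_two]
    push_cast
    rw [smul_eq_mul]
    ring
  rw [h1, smul_mul_assoc, ← pow_add, show 3 + (m - 1) = m + 1 + 1 by omega,
    PowerSeries.coeff_smul, PowerSeries.mk_one_pow_eq_mk_choose_add, PowerSeries.coeff_mk,
    show m + 1 + (n - (m - 1)) = n + 2 by omega] at h
  have e1 := Nat.add_one_mul_choose_eq (n + 1) m
  have e2 := Nat.add_one_mul_choose_eq n (m - 1)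
  rw [show m - 1 + 1 = m by omega] at e2
  have e1' : ((n : ℝ) + 1 + 1) * ((n + 1).choose m) = ((n + 2).choose (m + 1)) * (m + 1) := by
    exact_mod_cast e1
  have e2' : ((n : ℝ) + 1) * (n.choose (m - 1)) = ((n + 1).choose m) * m := by
    exact_mod_cast e2
  have hc : (0 : ℝ) < n.choose (m - 1) := by exact_mod_cast Nat.choose_pos hn
  apply mul_left_cancel₀ hc.ne'
  rw [h, smul_eq_mul]
  have hm1 : (m : ℝ) + 1 ≠ 0 := by positivity
  field_simp
  linear_combination (-(m : ℝ)) * e1' - (n + 2) * e2'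

end

/-- The asymptotic density of fringe subtrees with `k` keys. -/
noncomputable def countDensity (m k : ℕ) : ℝ := 1 / ((Hm m - 1) * ((k : ℝ) + 1) * (k + 2))

section
variable {m k : ℕ} {β : ℝ}

theorem one_le_succ_rpow (hβ : 0 ≤ β) (n : ℕ) : (1 : ℝ) ≤ ((n : ℝ) + 1) ^ β :=
  Real.one_le_rpow (by linarith [(Nat.cast_nonneg n : (0 : ℝ) ≤ n)]) hβ

theorem abs_meanCount_sub_le (hm : 2 ≤ m) (h0 : 0 < β) (h1 : β < 1)
    (hroots : ∀ z : ℂ, (ascPochhammer ℂ (m - 1)).eval z = (m.factorial : ℂ) → z ≠ 2 →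
      z.re < 1 + β) :
    ∃ C : ℝ, ∀ n : ℕ, |meanCount m k n - countDensity m k * (n + 1)| ≤ C * ((n : ℝ) + 1) ^ β := by
  have h := abs_sub_linear_le_of_splitOp hm h0 h1 hroots (a := meanCount m k) (r := tollAt k)
    (meanCount_rec hm) ⟨1, fun n => by
      have := one_le_succ_rpow h0.le n
      rw [tollAt]
      split_ifs <;> simp <;> linarith⟩
  have ht : ∑' j : ℕ, tollAt k j / (((j : ℝ) + 1) * (j + 2)) = 1 / (((k : ℝ) + 1) * (k + 2)) := by
    rw [tsum_eq_single k fun j hj => by rw [tollAt, if_neg hj, zero_div], tollAt, if_pos rfl]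
  rw [ht, div_div] at h
  rw [countDensity]
  convert h using 8
  ring

theorem abs_splitBias_le (hm : 2 ≤ m) (h0 : 0 < β) {C : ℝ}
    (hC : ∀ n : ℕ, |meanCount m k n - countDensity m k * (n + 1)| ≤ C * ((n : ℝ) + 1) ^ β)
    {n : ℕ} (hn : m - 1 ≤ n) {c : Fin m → ℕ} (hc : c ∈ comps m n) :
    |splitBias m k n c| ≤ (m * C + 1 + C) * ((n : ℝ) + 1) ^ β := by
  have hC0 : 0 ≤ C := by simpa using (abs_nonneg _).trans (hC 0)
  have e : splitBias m k n c = ∑ i, (meanCount m k (c i) - countDensity m k * (c i + 1)) +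
      tollAt k n - (meanCount m k n - countDensity m k * (n + 1)) := by
    rw [Finset.sum_sub_distrib, ← Finset.mul_sum, sum_succ_of_mem_comps hm hn hc, splitBias]
    ring
  have h1 : |∑ i, (meanCount m k (c i) - countDensity m k * (c i + 1))| ≤
      m * (C * ((n : ℝ) + 1) ^ β) := by
    refine (Finset.abs_sum_le_sum_abs _ _).trans ?_
    refine (Finset.sum_le_sum (g := fun _ => C * ((n : ℝ) + 1) ^ β) fun i _ => ?_).trans
      (by simp)
    refine (hC (c i)).trans ?_
    have : (c i : ℝ) ≤ n := by exact_mod_cast (lt_of_mem_comps hm hn hc i).le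
    gcongr
  have h2 : |tollAt k n| ≤ ((n : ℝ) + 1) ^ β := by
    have := one_le_succ_rpow h0.le n
    rw [tollAt]
    split_ifs <;> simp <;> linarith
  have h3 := hC n
  rw [e]
  refine (abs_sub _ _).trans ?_
  have h4 := abs_add_le (∑ i, (meanCount m k (c i) - countDensity m k * (c i + 1))) (tollAt k n)
  linarith

theorem meanCount_zero (hm : 2 ≤ m) : meanCount m k 0 = tollAt k 0 :=
  meanCount_of_lt (by omega)

theorem eq_of_splitBias_eq_zero (hm : 2 ≤ m)
    (h : ∀ n, m - 1 ≤ n → ∀ c ∈ comps m n, splitBias m k n c = 0) : k = 0 ∧ m = 2 := by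
  set e := meanCount m k with he
  obtain ⟨p, rfl⟩ : ∃ p, m = p + 2 := ⟨m - 2, by omega⟩
  have hstep : ∀ a, e (a + 1) - e a = e 1 - e 0 := by
    intro a
    have hc : ∀ x y : ℕ, x + y = a + 1 →
        (Fin.cons x (Fin.cons y fun _ => 0) : Fin (p + 2) → ℕ) ∈ comps (p + 2) (a + 1 + (p + 1)) := by
      intro x y hxy
      rw [mem_comps, Fin.sum_univ_succ, Fin.sum_univ_succ]
      simp
      omega
    have h1 := h _ (by omega) _ (hc (a + 1) 0 (by omega))
    have h2 := h _ (by omega) _ (hc a 1 (by omega))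
    rw [splitBias, Fin.sum_univ_succ, Fin.sum_univ_succ] at h1 h2
    simp only [Fin.cons_zero, Fin.cons_succ, ← he] at h1 h2
    linarith
  have haff : ∀ a, e a = e 0 + a * (e 1 - e 0) := by
    intro a
    induction a with
    | zero => simp
    | succ a ih =>
      push_cast
      linarith [hstep a]
  set E := e 0 with hE
  set d := e 1 - E with hd
  have hsum : ∀ n, p + 1 ≤ n → (p + 1) * (E - d) + tollAt k n = 0 := by
    intro n hn
    obtain ⟨c, hc⟩ := comps_nonempty hm (n := n) (by omega)
    have h1 := h n (by omega) c hc
    rw [splitBias, ← he, haff n, Finset.sum_congr rfl fun i _ => haff (c i),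
      Finset.sum_add_distrib, ← Finset.sum_mul] at h1
    have h2 := sum_succ_of_mem_comps hm (by omega) hc
    rw [Finset.sum_add_distrib] at h2
    simp only [Finset.sum_const, Finset.card_univ, Fintype.card_fin, nsmul_eq_mul, mul_one] at h1 h2
    have h3 : ∑ i, (c i : ℝ) = n + 1 - (p + 2 : ℕ) := by linarith
    rw [h3] at h1
    push_cast at h1
    linarith
  have hEd : E = d := by
    have h1 := hsum (p + 1 + k + 1) (by omega)
    rw [tollAt, if_neg (by omega), add_zero] at h1
    have : (p : ℝ) + 1 ≠ 0 := by positivity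
    linarith [(mul_eq_zero.1 h1).resolve_left this]
  have hk : k < p + 1 := by
    by_contra! hk
    have h1 := hsum k hk
    rw [hEd, tollAt, if_pos rfl] at h1
    norm_num at h1
  have hek : e k = 1 := by
    rw [he, meanCount_of_lt (by omega), tollAt, if_pos rfl]
  have he0 : E = tollAt k 0 := meanCount_zero hm
  by_cases hk0 : k = 0
  · refine ⟨hk0, ?_⟩
    by_contra hp
    have h1 : e 1 = tollAt k 1 := meanCount_of_lt (by omega)
    rw [tollAt, if_neg (by omega)] at h1
    rw [tollAt, if_pos hk0.symm] at he0
    linarith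
  · exfalso
    rw [tollAt, if_neg (Ne.symm hk0)] at he0
    have := haff k
    rw [← hEd, he0, hek] at this
    norm_num at this

theorem biasSq_le (hm : 2 ≤ m) {C : ℝ}
    (hC : ∀ n, m - 1 ≤ n → ∀ c ∈ comps m n, |splitBias m k n c| ≤ C * ((n : ℝ) + 1) ^ β) (n : ℕ) :
    biasSq m k n ≤ C ^ 2 * ((n : ℝ) + 1) ^ (2 * β) := by
  rw [biasSq]
  split_ifs with hn
  · refine Finset.expect_le (comps_nonempty hm hn) fun c hc => ?_
    rw [mul_comm 2 β, Real.rpow_mul (by positivity), Real.rpow_two, ← mul_pow, ← sq_abs]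
    exact pow_le_pow_left₀ (abs_nonneg _) (hC n hn c hc) 2
  · positivity

theorem exists_variance (hm : 2 ≤ m) (h0 : 0 < β) (h1 : β < 1 / 2)
    (hroots : ∀ z : ℂ, (ascPochhammer ℂ (m - 1)).eval z = (m.factorial : ℂ) → z ≠ 2 →
      z.re < 1 + β)
    {C : ℝ}
    (hC : ∀ n, m - 1 ≤ n → ∀ c ∈ comps m n, |splitBias m k n c| ≤ C * ((n : ℝ) + 1) ^ β) :
    ∃ s : ℝ, 0 ≤ s ∧ (¬ (k = 0 ∧ m = 2) → 0 < s) ∧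
      ∃ D : ℝ, ∀ n : ℕ, |momentCount 2 m k n - s * (n + 1)| ≤ D * ((n : ℝ) + 1) ^ (2 * β) := by
  have hb : ∀ n : ℕ, |biasSq m k n| ≤ C ^ 2 * ((n : ℝ) + 1) ^ (2 * β) := by
    intro n
    rw [abs_of_nonneg biasSq_nonneg]
    exact biasSq_le hm hC n
  have hH : 0 < Hm m - 1 := by linarith [one_lt_Hm hm]
  have hterm : ∀ j : ℕ, 0 ≤ biasSq m k j / (((j : ℝ) + 1) * (j + 2)) := fun j =>
    div_nonneg biasSq_nonneg (by positivity)
  refine ⟨_, div_nonneg (tsum_nonneg hterm) hH.le, fun hne => ?_,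
    abs_sub_linear_le_of_splitOp hm (by linarith) (by linarith)
      (fun z hz hz2 => (hroots z hz hz2).trans (by linarith)) (momentCount_two_rec hm) ⟨_, hb⟩⟩
  refine div_pos ?_ hH
  obtain ⟨j, hj⟩ : ∃ j, biasSq m k j ≠ 0 := by
    by_contra! hcon
    refine hne (eq_of_splitBias_eq_zero hm fun n hn c hc => ?_)
    have h2 := hcon n
    rw [biasSq, if_pos hn, Finset.expect_eq_zero_iff_of_nonneg fun _ _ => sq_nonneg _] at h2
    exact pow_eq_zero_iff two_ne_zero |>.1 (h2 c hc)
  exact (summable_div_of_le (by linarith) (by linarith) hb).tsum_pos hterm j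
    (div_pos (lt_of_le_of_ne biasSq_nonneg hj.symm) (by positivity))

theorem momentCount_two_le {s D : ℝ} (h1 : β < 1 / 2)
    (hD : ∀ n : ℕ, |momentCount 2 m k n - s * (n + 1)| ≤ D * ((n : ℝ) + 1) ^ (2 * β)) (n : ℕ) :
    momentCount 2 m k n ≤ (s + D) * (n + 1) := by
  have hD0 : 0 ≤ D := by simpa using (abs_nonneg _).trans (hD 0)
  have h2 : ((n : ℝ) + 1) ^ (2 * β) ≤ n + 1 := by
    calc ((n : ℝ) + 1) ^ (2 * β) ≤ ((n : ℝ) + 1) ^ (1 : ℝ) :=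
          Real.rpow_le_rpow_of_exponent_le (by linarith [(Nat.cast_nonneg n : (0 : ℝ) ≤ n)])
            (by linarith)
      _ = _ := Real.rpow_one _
  have h3 := (le_abs_self _).trans (hD n)
  nlinarith

theorem exists_momentCount_four_le (hm : 2 ≤ m) (h1 : β < 1 / 2) {C D : ℝ}
    (hC : ∀ n, m - 1 ≤ n → ∀ c ∈ comps m n, |splitBias m k n c| ≤ C * ((n : ℝ) + 1) ^ β)
    (hD : ∀ n : ℕ, momentCount 2 m k n ≤ D * (n + 1)) :
    ∃ K : ℝ, 0 ≤ K ∧ ∀ n : ℕ, momentCount 4 m k n ≤ K * (((n : ℝ) + 1) * (n + 2)) := by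
  set K₁ := 15 / 4 * D ^ 2 + 4913 * C ^ 4 with hK₁
  have hK₁0 : 0 ≤ K₁ := by positivity
  refine ⟨6 * K₁, by positivity, fun n => ?_⟩
  induction n using Nat.strong_induction_on with
  | _ n ih =>
    have hn0 : (0 : ℝ) ≤ n := Nat.cast_nonneg n
    by_cases hn : m - 1 ≤ n
    · have hbias : ∀ c ∈ comps m n, splitBias m k n c ^ 4 ≤ C ^ 4 * ((n : ℝ) + 1) ^ 2 := by
        intro c hc
        have h2 : |splitBias m k n c| ^ 4 ≤ (C * ((n : ℝ) + 1) ^ β) ^ 4 :=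
          pow_le_pow_left₀ (abs_nonneg _) (hC n hn c hc) 4
        have h3 : (((n : ℝ) + 1) ^ β) ^ 4 ≤ ((n : ℝ) + 1) ^ 2 := by
          rw [← Real.rpow_natCast, ← Real.rpow_natCast, ← Real.rpow_mul (by positivity)]
          apply Real.rpow_le_rpow_of_exponent_le (by linarith)
          push_cast
          linarith
        rw [pow_abs, abs_of_nonneg (by positivity)] at h2
        rw [mul_pow] at h2
        exact h2.trans (by gcongr)
      have hmain : momentCount 4 m k n ≤ 5 / 4 * splitOp m (momentCount 4 m k) n +
          K₁ * ((n : ℝ) + 1) ^ 2 := by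
        rw [momentCount_rec hm hn, splitOp, if_pos hn, Finset.mul_expect,
          ← Finset.expect_const (comps_nonempty hm hn) (K₁ * ((n : ℝ) + 1) ^ 2),
          ← Finset.expect_add_distrib]
        refine Finset.expect_le_expect fun c hc => ?_
        have h4 := expect_pi_sum_pow_four_le (fun i π => keyCount m k (c i) π - meanCount m k (c i))
          fun i => expect_keyCount_sub_mean _
        have h5 : ∑ i, 𝔼 π, (keyCount m k (c i) π - meanCount m k (c i)) ^ 2 ≤ D * (n + 1) := by
          rw [← sum_succ_of_mem_comps hm hn hc, Finset.mul_sum]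
          exact Finset.sum_le_sum fun i _ => hD (c i)
        have h6 : (0 : ℝ) ≤ ∑ i, 𝔼 π, (keyCount m k (c i) π - meanCount m k (c i)) ^ 2 :=
          Finset.sum_nonneg fun i _ => Finset.expect_nonneg fun _ _ => sq_nonneg _
        calc _ ≤ 𝔼 ρ : (∀ i, Equiv.Perm (Fin (c i))),
              (5 / 4 * (∑ i, (keyCount m k (c i) (ρ i) - meanCount m k (c i))) ^ 4 +
                4913 * splitBias m k n c ^ 4) :=
              Finset.expect_le_expect fun ρ _ => add_pow_four_le _ _
          _ = 5 / 4 * 𝔼 ρ : (∀ i, Equiv.Perm (Fin (c i))),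
              (∑ i, (keyCount m k (c i) (ρ i) - meanCount m k (c i))) ^ 4 +
                4913 * splitBias m k n c ^ 4 := by
              rw [Finset.expect_add_distrib, Fintype.expect_const, Finset.mul_expect]
          _ ≤ 5 / 4 * (∑ i, momentCount 4 m k (c i) + 3 * (D * (n + 1)) ^ 2) +
                4913 * (C ^ 4 * ((n : ℝ) + 1) ^ 2) := by
              gcongr
              · refine h4.trans ?_
                gcongr
                exact le_rfl
              · exact hbias c hc
          _ = _ := by rw [hK₁]; ring
      have h7 := splitOp_mono (n := n) hm ih
      rw [splitOp_const_mul, splitOp_succ_mul_succ hm hn] at h7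
      have h8 : (2 : ℝ) / (m + 1) ≤ 2 / 3 := by
        have : (2 : ℝ) ≤ m := by exact_mod_cast hm
        gcongr
        linarith
      have h9 : (2 : ℝ) / (m + 1) * ((n + 1) * (n + 2)) ≤ 2 / 3 * ((n + 1) * (n + 2)) := by gcongr
      have h10 : 6 * K₁ * ((2 : ℝ) / (m + 1) * ((n + 1) * (n + 2))) ≤
          6 * K₁ * (2 / 3 * ((n + 1) * (n + 2))) := by gcongr
      have h11 : K₁ * ((n : ℝ) + 1) ^ 2 ≤ K₁ * ((n + 1) * (n + 2)) := by
        gcongr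
        nlinarith
      linarith
    · rw [momentCount_of_lt (by norm_num) (by omega)]
      positivity

end

section
variable {m n k : ℕ}

theorem norm_prod_sub_prod_le {ι : Type*} (s : Finset ι) (a b : ι → ℂ)
    (ha : ∀ i ∈ s, ‖a i‖ ≤ 1) (hb : ∀ i ∈ s, ‖b i‖ ≤ 1) :
    ‖∏ i ∈ s, a i - ∏ i ∈ s, b i‖ ≤ ∑ i ∈ s, ‖a i - b i‖ := by
  classical
  induction s using Finset.induction_on with
  | empty => simp
  | insert j s hj ih =>
    rw [Finset.prod_insert hj, Finset.prod_insert hj, Finset.sum_insert hj]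
    have h1 := ih (fun i hi => ha i (Finset.mem_insert_of_mem hi))
      fun i hi => hb i (Finset.mem_insert_of_mem hi)
    have h2 : ‖∏ i ∈ s, a i‖ ≤ 1 := by
      rw [norm_prod]
      exact Finset.prod_le_one (fun i _ => norm_nonneg _)
        fun i hi => ha i (Finset.mem_insert_of_mem hi)
    have h3 := hb j (Finset.mem_insert_self _ _)
    calc ‖a j * ∏ i ∈ s, a i - b j * ∏ i ∈ s, b i‖
        = ‖(a j - b j) * ∏ i ∈ s, a i + b j * (∏ i ∈ s, a i - ∏ i ∈ s, b i)‖ := by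
          congr 1; ring
      _ ≤ ‖(a j - b j) * ∏ i ∈ s, a i‖ + ‖b j * (∏ i ∈ s, a i - ∏ i ∈ s, b i)‖ :=
          norm_add_le _ _
      _ ≤ ‖a j - b j‖ + ∑ i ∈ s, ‖a i - b i‖ := by
          rw [norm_mul, norm_mul]
          exact add_le_add (mul_le_of_le_one_right (norm_nonneg _) h2)
            ((mul_le_of_le_one_left (norm_nonneg _) h3).trans h1)

theorem norm_exp_mul_I_sub_le (x : ℝ) :
    ‖Complex.exp (x * Complex.I) - (1 + x * Complex.I - x ^ 2 / 2)‖ ≤ 4 * |x| ^ 3 := by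
  have hx : ‖(x : ℂ) * Complex.I‖ = |x| := by simp
  have hx2 : ‖(x : ℂ) ^ 2 / 2‖ = |x| ^ 2 / 2 := by simp
  rcases le_or_gt |x| 1 with h | h
  · have h1 := Complex.norm_exp_sub_sum_le_norm_mul_exp ((x : ℂ) * Complex.I) 3
    rw [hx] at h1
    have h2 : ∑ i ∈ range 3, ((x : ℂ) * Complex.I) ^ i / (i.factorial : ℂ) =
        1 + x * Complex.I - x ^ 2 / 2 := by
      simp [Finset.sum_range_succ, mul_pow, Nat.factorial]
      ring
    rw [h2] at h1
    have h3 : Real.exp |x| ≤ 4 :=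
      (Real.exp_le_exp.2 h).trans (by linarith [Real.exp_one_lt_d9])
    nlinarith [pow_nonneg (abs_nonneg x) 3]
  · have h1 : ‖Complex.exp (x * Complex.I)‖ = 1 := Complex.norm_exp_ofReal_mul_I x
    have h2 : ‖Complex.exp (x * Complex.I) - (1 + x * Complex.I - x ^ 2 / 2)‖ ≤
        1 + (1 + |x| + |x| ^ 2 / 2) := by
      refine (norm_sub_le _ _).trans (add_le_add h1.le ((norm_sub_le _ _).trans
        (add_le_add ((norm_add_le _ _).trans (add_le_add (by simp) hx.le)) hx2.le)))
    have h3 : (1 : ℝ) ≤ |x| ^ 3 := one_le_pow₀ h.le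
    have h4 : |x| ≤ |x| ^ 3 := le_self_pow₀ h.le (by norm_num)
    have h5 : |x| ^ 2 ≤ |x| ^ 3 := pow_le_pow_right₀ h.le (by norm_num)
    linarith

theorem abs_exp_neg_sub_le {a : ℝ} (ha : 0 ≤ a) : |Real.exp (-a) - (1 - a)| ≤ a ^ 2 := by
  have h1 := Real.one_sub_le_exp_neg a
  rw [abs_of_nonneg (by linarith)]
  rcases le_or_gt a 1 with h | h
  · have := Real.abs_exp_sub_one_sub_id_le (x := -a) (by rwa [abs_neg, abs_of_nonneg ha])
    have := (abs_le.1 this).2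
    linarith [neg_sq a]
  · have : Real.exp (-a) ≤ 1 := Real.exp_le_one_iff.2 (by linarith)
    nlinarith

/-- The characteristic function of the number of fringe subtrees with `k` keys, centered
at `μ * (n + 1)`. -/
noncomputable def charCount (m k : ℕ) (μ t : ℝ) (n : ℕ) : ℂ :=
  𝔼 π, Complex.exp (((t * (keyCount m k n π - μ * (n + 1)) : ℝ) : ℂ) * Complex.I)

/-- The distance between the characteristic function of the number of fringe subtrees with `k`
keys and that of the normal distribution of variance `s * (n + 1)`. -/
noncomputable def charDist (m k : ℕ) (μ s t : ℝ) (n : ℕ) : ℝ :=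
  ‖charCount m k μ t n - (Real.exp (-(s * (n + 1) * t ^ 2 / 2)) : ℝ)‖

theorem norm_expect_le_expect_norm {ι : Type*} (s : Finset ι) (f : ι → ℂ) :
    ‖𝔼 i ∈ s, f i‖ ≤ 𝔼 i ∈ s, ‖f i‖ := RCLike.norm_expect_le (K := ℂ)

theorem norm_charCount_le {μ t : ℝ} (n : ℕ) : ‖charCount m k μ t n‖ ≤ 1 := by
  refine (norm_expect_le_expect_norm _ _).trans ?_
  simp only [Complex.norm_exp_ofReal_mul_I]
  rw [Fintype.expect_const]

theorem charCount_rec (hm : 2 ≤ m) (hn : m - 1 ≤ n) (hk : n ≠ k) {μ t : ℝ} :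
    charCount m k μ t n = 𝔼 c ∈ comps m n, ∏ i, charCount m k μ t (c i) := by
  rw [charCount, expect_keyCount (k := k) hm hn
    (fun x : ℝ => Complex.exp (((t * (x - μ * (n + 1)) : ℝ) : ℂ) * Complex.I))]
  apply Finset.expect_congr rfl
  intro c hc
  simp only [charCount]
  rw [← expect_pi_prod]
  apply Finset.expect_congr rfl
  intro ρ _
  rw [← Complex.exp_sum]
  congr 1
  rw [← Finset.sum_mul, ← Complex.ofReal_sum, tollAt, if_neg hk, ← Finset.mul_sum,
    Finset.sum_sub_distrib, ← Finset.mul_sum, sum_succ_of_mem_comps hm hn hc, add_zero]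

theorem charDist_le_splitOp (hm : 2 ≤ m) (hn : m - 1 ≤ n) (hk : n ≠ k) {μ s t : ℝ}
    (hs : 0 ≤ s) : charDist m k μ s t n ≤ splitOp m (charDist m k μ s t) n := by
  have h : ((Real.exp (-(s * (n + 1) * t ^ 2 / 2)) : ℝ) : ℂ) = 𝔼 c ∈ comps m n,
      ∏ i, ((Real.exp (-(s * (c i + 1) * t ^ 2 / 2)) : ℝ) : ℂ) := by
    rw [← Finset.expect_const (comps_nonempty hm hn)
      ((Real.exp (-(s * (n + 1) * t ^ 2 / 2)) : ℝ) : ℂ)]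
    apply Finset.expect_congr rfl
    intro c hc
    rw [← Complex.ofReal_prod, ← Real.exp_sum, ← sum_succ_of_mem_comps hm hn hc]
    congr 2
    rw [Finset.sum_neg_distrib, Finset.mul_sum, Finset.sum_mul, Finset.sum_div]
  rw [charDist, h, charCount_rec hm hn hk, ← Finset.expect_sub_distrib, splitOp, if_pos hn]
  refine (norm_expect_le_expect_norm _ _).trans (Finset.expect_le_expect fun c _ => ?_)
  refine norm_prod_sub_prod_le _ _ _ (fun i _ => norm_charCount_le _) fun i _ => ?_
  rw [Complex.norm_real, Real.norm_of_nonneg (Real.exp_pos _).le]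
  refine Real.exp_le_one_iff.2 (neg_nonpos.2 ?_)
  positivity

theorem le_of_le_splitOp {δ : ℕ → ℝ} {a b M : ℝ} (hm : 2 ≤ m) (ha : 0 ≤ a)
    (hM : (m : ℝ) ≤ M) (hk : (k : ℝ) + 1 ≤ M)
    (h : ∀ n, m - 1 ≤ n → n ≠ k → δ n ≤ splitOp m δ n)
    (hδ : ∀ n : ℕ, (n : ℝ) + 1 ≤ M → δ n ≤ a + b * (n + 1)) (n : ℕ) :
    δ n ≤ a * (1 + (m + 1) * ((n + 1) * (n + 2)) / M ^ 2) + b * (n + 1) := by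
  have hM0 : 0 < M := lt_of_lt_of_le (by positivity) hk
  induction n using Nat.strong_induction_on with
  | _ n ih =>
    rcases le_or_gt ((n : ℝ) + 1) M with hn | hn
    · refine (hδ n hn).trans (add_le_add_left ?_ _)
      exact le_mul_of_one_le_right ha (le_add_of_nonneg_right (by positivity))
    · have hmn : m - 1 ≤ n := by
        have : (m : ℝ) < n + 1 := hM.trans_lt hn
        have : m < n + 1 := by exact_mod_cast this
        omega
      have hnk : n ≠ k := by
        rintro rfl
        linarith
      have h1 := (h n hmn hnk).trans (splitOp_mono hm ih)
      have h2 : splitOp m (fun j => a * (1 + (m + 1) * (((j : ℝ) + 1) * (j + 2)) / M ^ 2)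
          + b * ((j : ℝ) + 1)) n = m * a +
          a * (m + 1) / M ^ 2 * (2 / (m + 1) * (((n : ℝ) + 1) * (n + 2))) + b * (n + 1) := by
        rw [← splitOp_const hm hmn, ← splitOp_succ_mul_succ hm hmn, ← splitOp_succ hm hmn,
          ← splitOp_const_mul, ← splitOp_const_mul, ← splitOp_add, ← splitOp_add]
        congr 1
        funext j
        ring
      rw [h2] at h1
      refine h1.trans (add_le_add_left ?_ _)
      have h3 : a * (m + 1) / M ^ 2 * (2 / (m + 1) * (((n : ℝ) + 1) * (n + 2))) =
          2 * a * (((n : ℝ) + 1) * (n + 2) / M ^ 2) := by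
        field_simp
      have h4 : (1 : ℝ) ≤ ((n : ℝ) + 1) * (n + 2) / M ^ 2 := by
        rw [one_le_div (by positivity)]
        nlinarith
      have h5 : (2 : ℝ) ≤ m := by exact_mod_cast hm
      rw [h3, mul_div_assoc ((m : ℝ) + 1)]
      nlinarith [mul_nonneg (mul_nonneg ha (by linarith : (0 : ℝ) ≤ m - 1))
        (sub_nonneg.2 h4)]

end

section
variable {m n k : ℕ}

theorem abs_pow_three_le {r : ℝ} (hr : 0 < r) (x : ℝ) :
    |x| ^ 3 ≤ (r * x ^ 2 + x ^ 4 / r) / 2 := by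
  have h : x ^ 4 / r = r * (x ^ 2 / r) ^ 2 := by field_simp
  have h1 : |x| * |x| = x ^ 2 := by rw [← sq, sq_abs]
  have h2 : |x| ^ 2 / r * r = x ^ 2 := by rw [sq_abs]; field_simp
  have h3 : x ^ 4 / r = r * (|x| ^ 2 / r) ^ 2 := by rw [h, sq_abs]
  have h4 : |x| ^ 3 = r * (|x| * (|x| ^ 2 / r)) := by field_simp
  rw [h3, h4, ← sq_abs x]
  nlinarith [mul_nonneg hr.le (sq_nonneg (|x| - |x| ^ 2 / r))]

theorem expect_abs_pow_three_le {D K : ℝ} (hD : ∀ n, momentCount 2 m k n ≤ D * ((n : ℝ) + 1))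
    (hK : ∀ n, momentCount 4 m k n ≤ K * (((n : ℝ) + 1) * (n + 2))) (hK0 : 0 ≤ K) (n : ℕ) :
    𝔼 π, |keyCount m k n π - meanCount m k n| ^ 3 ≤
      (D / 2 + K) * (Real.sqrt (n + 1) * (n + 1)) := by
  have hN : (0 : ℝ) < n + 1 := by positivity
  set r := Real.sqrt ((n : ℝ) + 1) with hr
  have hr0 : 0 < r := Real.sqrt_pos.2 hN
  have hrr : r ^ 2 = n + 1 := Real.sq_sqrt hN.le
  have h1 : 𝔼 π, |keyCount m k n π - meanCount m k n| ^ 3 ≤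
      (r * momentCount 2 m k n + momentCount 4 m k n / r) / 2 := by
    rw [momentCount, momentCount, Finset.mul_expect, Finset.expect_div,
      ← Finset.expect_add_distrib, Finset.expect_div]
    exact Finset.expect_le_expect fun π _ => abs_pow_three_le hr0 _
  have h2 : momentCount 4 m k n / r ≤ 2 * K * (r * (n + 1)) := by
    rw [div_le_iff₀ hr0]
    have : 2 * K * (r * (n + 1)) * r = 2 * K * (n + 1) * r ^ 2 := by ring
    rw [this, hrr]
    refine (hK n).trans ?_
    have : 0 ≤ K * ((n : ℝ) + 1) * n := by positivity
    nlinarith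
  have h3 : r * momentCount 2 m k n ≤ D * (r * (n + 1)) := by
    have := mul_le_mul_of_nonneg_left (hD n) hr0.le
    linarith
  linarith

theorem charDist_le {C D E K β μ s : ℝ} (hs : 0 ≤ s) (hK0 : 0 ≤ K)
    (hC : ∀ n : ℕ, |meanCount m k n - μ * (n + 1)| ≤ C * ((n : ℝ) + 1) ^ β)
    (hD : ∀ n : ℕ, |momentCount 2 m k n - s * (n + 1)| ≤ D * ((n : ℝ) + 1) ^ (2 * β))
    (hE : ∀ n, momentCount 2 m k n ≤ E * ((n : ℝ) + 1))
    (hK : ∀ n, momentCount 4 m k n ≤ K * (((n : ℝ) + 1) * (n + 2))) (t : ℝ) (n : ℕ) :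
    charDist m k μ s t n ≤ |t| * (C * ((n : ℝ) + 1) ^ β) +
      t ^ 2 / 2 * (D * ((n : ℝ) + 1) ^ (2 * β)) +
      4 * |t| ^ 3 * ((E / 2 + K) * (Real.sqrt (n + 1) * (n + 1))) +
      (s * (n + 1) * t ^ 2 / 2) ^ 2 := by
  set Z : Equiv.Perm (Fin n) → ℝ := fun π => keyCount m k n π - meanCount m k n with hZ
  set a : ℝ := s * (n + 1) * t ^ 2 / 2 with ha
  have ha0 : 0 ≤ a := by positivity
  set χ : ℂ := 𝔼 π, Complex.exp (((t * Z π : ℝ) : ℂ) * Complex.I) with hχ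
  have h1 : ‖charCount m k μ t n - χ‖ ≤ |t| * (C * ((n : ℝ) + 1) ^ β) := by
    rw [charCount, hχ, ← Finset.expect_sub_distrib]
    refine (norm_expect_le_expect_norm _ _).trans ?_
    refine (Finset.expect_le_expect fun π _ => ?_).trans (Fintype.expect_const _).le
    have h : Complex.exp (((t * (keyCount m k n π - μ * (n + 1)) : ℝ) : ℂ) * Complex.I) -
        Complex.exp (((t * Z π : ℝ) : ℂ) * Complex.I) =
        Complex.exp (((t * Z π : ℝ) : ℂ) * Complex.I) *
        (Complex.exp (Complex.I * ((t * (meanCount m k n - μ * (n + 1)) : ℝ) : ℂ)) - 1) := by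
      rw [mul_sub (Complex.exp _), ← Complex.exp_add, mul_one]
      congr 2
      rw [hZ]
      push_cast
      ring
    rw [h, norm_mul, Complex.norm_exp_ofReal_mul_I, one_mul]
    refine (Real.norm_exp_I_mul_ofReal_sub_one_le).trans ?_
    rw [Real.norm_eq_abs, abs_mul]
    exact mul_le_mul_of_nonneg_left (hC n) (abs_nonneg t)
  have h2 : ‖χ - ((1 - t ^ 2 / 2 * momentCount 2 m k n : ℝ) : ℂ)‖ ≤
      4 * |t| ^ 3 * ((E / 2 + K) * (Real.sqrt (n + 1) * (n + 1))) := by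
    have h : ((1 - t ^ 2 / 2 * momentCount 2 m k n : ℝ) : ℂ) =
        𝔼 π, (1 + ((t * Z π : ℝ) : ℂ) * Complex.I - ((t * Z π : ℝ) : ℂ) ^ 2 / 2) := by
      have e1 : (𝔼 π, ((Z π : ℝ) : ℂ)) = 0 := by
        have := congrArg (fun x : ℝ => (x : ℂ)) (expect_keyCount_sub_mean (m := m) (k := k) n)
        simpa [hZ, Complex.ofReal_expect] using this
      have e2 : ((momentCount 2 m k n : ℝ) : ℂ) = 𝔼 π, ((Z π : ℝ) : ℂ) ^ 2 := by
        simp [momentCount, hZ, Complex.ofReal_expect]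
      rw [Finset.expect_sub_distrib, Finset.expect_add_distrib, Fintype.expect_const,
        ← Finset.expect_mul, ← Finset.expect_div]
      simp only [Complex.ofReal_mul, mul_pow]
      rw [← Finset.mul_expect, ← Finset.mul_expect, e1, ← e2]
      push_cast
      ring
    rw [h, hχ, ← Finset.expect_sub_distrib]
    refine (norm_expect_le_expect_norm _ _).trans ?_
    refine (Finset.expect_le_expect fun π _ => norm_exp_mul_I_sub_le (t * Z π)).trans ?_
    simp only [abs_mul, mul_pow]
    rw [← Finset.mul_expect, ← Finset.mul_expect, mul_assoc]
    exact mul_le_mul_of_nonneg_left (mul_le_mul_of_nonneg_left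
      (expect_abs_pow_three_le hE hK hK0 n) (by positivity)) (by norm_num)
  have h3 : ‖((1 - t ^ 2 / 2 * momentCount 2 m k n : ℝ) : ℂ) - ((1 - a : ℝ) : ℂ)‖ ≤
      t ^ 2 / 2 * (D * ((n : ℝ) + 1) ^ (2 * β)) := by
    rw [← Complex.ofReal_sub, Complex.norm_real, Real.norm_eq_abs]
    have : 1 - t ^ 2 / 2 * momentCount 2 m k n - (1 - a) =
      -(t ^ 2 / 2 * (momentCount 2 m k n - s * (n + 1))) := by rw [ha]; ring
    rw [this, abs_neg, abs_mul, abs_of_nonneg (by positivity : 0 ≤ t ^ 2 / 2)]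
    exact mul_le_mul_of_nonneg_left (hD n) (by positivity)
  have h4 : ‖((1 - a : ℝ) : ℂ) - ((Real.exp (-a) : ℝ) : ℂ)‖ ≤ a ^ 2 := by
    rw [← Complex.ofReal_sub, Complex.norm_real, Real.norm_eq_abs, abs_sub_comm]
    exact abs_exp_neg_sub_le ha0
  rw [charDist]
  have e1 := norm_sub_le_norm_sub_add_norm_sub (charCount m k μ t n) χ ((Real.exp (-a) : ℝ) : ℂ)
  have e2 := norm_sub_le_norm_sub_add_norm_sub χ ((1 - t ^ 2 / 2 * momentCount 2 m k n : ℝ) : ℂ)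
    ((Real.exp (-a) : ℝ) : ℂ)
  have e3 := norm_sub_le_norm_sub_add_norm_sub ((1 - t ^ 2 / 2 * momentCount 2 m k n : ℝ) : ℂ)
    ((1 - a : ℝ) : ℂ) ((Real.exp (-a) : ℝ) : ℂ)
  linarith

end

section
open Filter Topology
variable {m n k : ℕ}

theorem charDist_le_of_scale (hm : 2 ≤ m) {C D E K β μ s q ρ t : ℝ} (h0 : 0 < β)
    (hs : 0 ≤ s) (hC0 : 0 ≤ C) (hD0 : 0 ≤ D) (hE0 : 0 ≤ E) (hK0 : 0 ≤ K)
    (hC : ∀ n : ℕ, |meanCount m k n - μ * (n + 1)| ≤ C * ((n : ℝ) + 1) ^ β)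
    (hD : ∀ n : ℕ, |momentCount 2 m k n - s * (n + 1)| ≤ D * ((n : ℝ) + 1) ^ (2 * β))
    (hE : ∀ n, momentCount 2 m k n ≤ E * ((n : ℝ) + 1))
    (hK : ∀ n, momentCount 4 m k n ≤ K * (((n : ℝ) + 1) * (n + 2)))
    (hρ : 0 < ρ) (hρ1 : ρ ≤ 1) (hmn : (m : ℝ) ≤ ρ ^ 2 * (n + 1))
    (hkn : (k : ℝ) + 1 ≤ ρ ^ 2 * (n + 1)) (ht : |t| * Real.sqrt (n + 1) ≤ q) :
    charDist m k μ s t n ≤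
      (C * (q * ((n : ℝ) + 1) ^ (β - 1 / 2)) + D * (q * ((n : ℝ) + 1) ^ (β - 1 / 2)) ^ 2) *
        (1 + 2 * (m + 1) / ρ ^ 4) + (4 * q ^ 3 * (E / 2 + K) + s ^ 2 * q ^ 4) * ρ := by
  have hN : (0 : ℝ) < n + 1 := by positivity
  set N : ℝ := (n : ℝ) + 1 with hNdef
  set r := Real.sqrt N with hr
  have hr0 : 0 < r := Real.sqrt_pos.2 hN
  have hrr : r ^ 2 = N := Real.sq_sqrt hN.le
  set M : ℝ := ρ ^ 2 * N with hM
  have hM0 : 0 < M := by positivity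
  have hMN : M ≤ N := mul_le_of_le_one_left hN.le (pow_le_one₀ hρ.le hρ1)
  have hsM : Real.sqrt M = ρ * r := by
    rw [hM, Real.sqrt_mul (by positivity), Real.sqrt_sq hρ.le]
  have ht0 : 0 ≤ |t| := abs_nonneg t
  have hq0 : 0 ≤ q := le_trans (by positivity) ht
  set a : ℝ := |t| * (C * M ^ β) + t ^ 2 / 2 * (D * M ^ (2 * β)) with ha
  set b : ℝ := 4 * |t| ^ 3 * ((E / 2 + K) * (ρ * r)) + s ^ 2 * t ^ 4 * M with hb
  have ha0 : 0 ≤ a := by positivity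
  have key := le_of_le_splitOp (k := k) (δ := charDist m k μ s t) (a := a) (b := b) (M := M)
    hm ha0 hmn hkn (fun j hj hjk => charDist_le_splitOp hm hj hjk hs) (fun j hj => by
      have hj0 : (0 : ℝ) < j + 1 := by positivity
      refine (charDist_le hs hK0 hC hD hE hK t j).trans ?_
      have e1 : ((j : ℝ) + 1) ^ β ≤ M ^ β := Real.rpow_le_rpow hj0.le hj h0.le
      have e2 : ((j : ℝ) + 1) ^ (2 * β) ≤ M ^ (2 * β) :=
        Real.rpow_le_rpow hj0.le hj (by positivity)
      have e3 : Real.sqrt ((j : ℝ) + 1) ≤ ρ * r := hsM ▸ Real.sqrt_le_sqrt hj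
      have f1 : |t| * (C * ((j : ℝ) + 1) ^ β) ≤ |t| * (C * M ^ β) := by gcongr
      have f2 : t ^ 2 / 2 * (D * ((j : ℝ) + 1) ^ (2 * β)) ≤
        t ^ 2 / 2 * (D * M ^ (2 * β)) := by gcongr
      have f3 : 4 * |t| ^ 3 * ((E / 2 + K) * (Real.sqrt (j + 1) * (j + 1))) ≤
        4 * |t| ^ 3 * ((E / 2 + K) * (ρ * r)) * (j + 1) := by
        rw [mul_assoc (4 * |t| ^ 3), mul_assoc (E / 2 + K)]
        gcongr
      have f4 : (s * ((j : ℝ) + 1) * t ^ 2 / 2) ^ 2 ≤ s ^ 2 * t ^ 4 * M * (j + 1) := by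
        have : (s * ((j : ℝ) + 1) * t ^ 2 / 2) ^ 2 =
          s ^ 2 * t ^ 4 * ((j : ℝ) + 1) * (j + 1) / 4 := by ring
        rw [this]
        have g1 : 0 ≤ s ^ 2 * t ^ 4 * (j + 1) * ((j : ℝ) + 1) := by positivity
        have g2 : s ^ 2 * t ^ 4 * (j + 1) * ((j : ℝ) + 1) ≤ s ^ 2 * t ^ 4 * M * (j + 1) := by
          gcongr
        linarith
      rw [ha, hb, add_mul]
      linarith) n
  refine key.trans (add_le_add ?_ ?_)
  · have hNβ : N ^ β = r * N ^ (β - 1 / 2) := by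
      rw [hr, Real.sqrt_eq_rpow, ← Real.rpow_add hN]
      ring_nf
    set u := N ^ (β - 1 / 2) with hu
    have hu0 : 0 < u := Real.rpow_pos_of_pos hN _
    have e1 : |t| * N ^ β ≤ q * u := by
      rw [hNβ, ← mul_assoc]
      gcongr
    have e2 : M ^ β ≤ N ^ β := Real.rpow_le_rpow hM0.le hMN h0.le
    have e3 : M ^ (2 * β) = (M ^ β) ^ 2 := by
      rw [mul_comm, Real.rpow_mul hM0.le]
      norm_num
    have hMβ : 0 ≤ M ^ β := Real.rpow_nonneg hM0.le _
    have e4 : |t| * M ^ β ≤ q * u := le_trans (by gcongr) e1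
    have e5 : a ≤ C * (q * u) + D * (q * u) ^ 2 := by
      have g1 : a = C * (|t| * M ^ β) + D * (|t| * M ^ β) ^ 2 / 2 := by
        rw [ha, e3, mul_pow, sq_abs]
        ring
      rw [g1]
      have g2 : C * (|t| * M ^ β) ≤ C * (q * u) := by gcongr
      have g3 : D * (|t| * M ^ β) ^ 2 ≤ D * (q * u) ^ 2 := by gcongr
      have g4 : 0 ≤ D * (|t| * M ^ β) ^ 2 := by positivity
      linarith
    have e6 : (m + 1) * (N * ((n : ℝ) + 2)) / M ^ 2 ≤ 2 * (m + 1) / ρ ^ 4 := by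
      rw [div_le_div_iff₀ (by positivity) (by positivity), hM]
      have : (n : ℝ) + 2 ≤ 2 * N := by rw [hNdef]; linarith [Nat.cast_nonneg (α := ℝ) n]
      calc (m + 1) * (N * ((n : ℝ) + 2)) * ρ ^ 4 ≤ (m + 1) * (N * (2 * N)) * ρ ^ 4 := by gcongr
        _ = 2 * (m + 1) * (ρ ^ 2 * N) ^ 2 := by ring
    gcongr
  · have g : b * N = (4 * (|t| * r) ^ 3 * (E / 2 + K)) * ρ + s ^ 2 * (|t| * r) ^ 4 * ρ * ρ := by
      have h4 : t ^ 4 = |t| ^ 4 := by rw [← abs_pow, abs_of_nonneg (by positivity)]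
      rw [hb, hM, ← hrr, h4]
      ring
    have h5 : 0 ≤ |t| * r := by positivity
    rw [g, add_mul]
    refine add_le_add (by gcongr) ?_
    refine (mul_le_of_le_one_right (by positivity) hρ1).trans ?_
    gcongr

theorem tendsto_charDist (hm : 2 ≤ m) {C D E K β μ s q : ℝ} {t : ℕ → ℝ} (h0 : 0 < β)
    (h1 : β < 1 / 2)
    (hs : 0 ≤ s) (hC0 : 0 ≤ C) (hD0 : 0 ≤ D) (hE0 : 0 ≤ E) (hK0 : 0 ≤ K)
    (hC : ∀ n : ℕ, |meanCount m k n - μ * (n + 1)| ≤ C * ((n : ℝ) + 1) ^ β)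
    (hD : ∀ n : ℕ, |momentCount 2 m k n - s * (n + 1)| ≤ D * ((n : ℝ) + 1) ^ (2 * β))
    (hE : ∀ n, momentCount 2 m k n ≤ E * ((n : ℝ) + 1))
    (hK : ∀ n, momentCount 4 m k n ≤ K * (((n : ℝ) + 1) * (n + 2)))
    (ht : ∀ n : ℕ, |t n| * Real.sqrt (n + 1) ≤ q) :
    Tendsto (fun n => charDist m k μ s (t n) n) atTop (𝓝 0) := by
  have hN : Tendsto (fun n : ℕ => (n : ℝ) + 1) atTop atTop :=
    tendsto_atTop_add_const_right _ _ tendsto_natCast_atTop_atTop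
  have hu : Tendsto (fun n : ℕ => q * ((n : ℝ) + 1) ^ (β - 1 / 2)) atTop (𝓝 0) := by
    have h := (tendsto_rpow_neg_atTop (by linarith : 0 < 1 / 2 - β)).comp hN
    simpa [Function.comp_def] using h.const_mul q
  have hq0 : 0 ≤ q := le_trans (by positivity) (ht 0)
  set L := 4 * q ^ 3 * (E / 2 + K) + s ^ 2 * q ^ 4 with hL
  have hL0 : 0 ≤ L := by positivity
  rw [Metric.tendsto_atTop']
  intro ε hε
  set ρ := min 1 (ε / (2 * (L + 1))) with hρdef
  have hρ : 0 < ρ := lt_min one_pos (by positivity)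
  have hρ1 : ρ ≤ 1 := min_le_left _ _
  have hLρ : L * ρ < ε / 2 := by
    have : ρ * (2 * (L + 1)) ≤ ε := (le_div_iff₀ (by positivity)).1 (min_le_right _ _)
    nlinarith
  have hv : Tendsto (fun n : ℕ => (C * (q * ((n : ℝ) + 1) ^ (β - 1 / 2)) +
      D * (q * ((n : ℝ) + 1) ^ (β - 1 / 2)) ^ 2) * (1 + 2 * (m + 1) / ρ ^ 4)) atTop (𝓝 0) := by
    simpa using ((hu.const_mul C).add ((hu.pow 2).const_mul D)).mul_const
      (1 + 2 * ((m : ℝ) + 1) / ρ ^ 4)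
  have hM := hN.const_mul_atTop (by positivity : 0 < ρ ^ 2)
  have hev := (hv.eventually_lt_const (half_pos hε)).and
    ((hM.eventually_ge_atTop (m : ℝ)).and (hM.eventually_ge_atTop ((k : ℝ) + 1)))
  obtain ⟨n₀, hn₀⟩ := eventually_atTop.1 hev
  refine ⟨n₀, fun n hn => ?_⟩
  obtain ⟨g1, g2, g3⟩ := hn₀ n hn.le
  have h := charDist_le_of_scale hm h0 hs hC0 hD0 hE0 hK0 hC hD hE hK hρ hρ1 g2 g3 (ht n)
  rw [Real.dist_eq, sub_zero, charDist, abs_norm, ← charDist]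
  rw [← hL] at h
  linarith

end

section
open Filter Topology MeasureTheory
variable {m n k : ℕ}

theorem pexp_eq_expect (f : Equiv.Perm (Fin n) → ℝ) : pexp n f = 𝔼 π, f π := by
  rw [pexp, Fintype.expect_eq_sum_div_card, Fintype.card_perm, Fintype.card_fin]

/-- The law of a functional of a uniformly random permutation. -/
noncomputable def permLaw (n : ℕ) (W : Equiv.Perm (Fin n) → ℝ) : Measure ℝ :=
  ((n.factorial : ENNReal))⁻¹ • ∑ π, Measure.dirac (W π)

instance (n : ℕ) (W : Equiv.Perm (Fin n) → ℝ) : IsProbabilityMeasure (permLaw n W) := by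
  constructor
  simp only [permLaw, Measure.smul_apply, Measure.finsetSum_apply, measure_univ, sum_const,
    card_univ, Fintype.card_perm, Fintype.card_fin, nsmul_eq_mul, mul_one, smul_eq_mul]
  exact ENNReal.inv_mul_cancel (by exact_mod_cast n.factorial_ne_zero)
    (ENNReal.natCast_ne_top _)

theorem integral_permLaw {E : Type*} [NormedAddCommGroup E] [NormedSpace ℝ E] [CompleteSpace E]
    (W : Equiv.Perm (Fin n) → ℝ) (f : ℝ → E) :
    ∫ x, f x ∂(permLaw n W) = (n.factorial : ℝ)⁻¹ • ∑ π, f (W π) := by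
  rw [permLaw, integral_smul_measure, integral_finsetSum_measure]
  · simp
  · intro π _
    exact integrable_dirac (by simp)

theorem tendstoGauss_of_tendsto_expect_exp {W : (n : ℕ) → Equiv.Perm (Fin n) → ℝ} {v : NNReal}
    (h : ∀ t : ℝ, Tendsto (fun n => 𝔼 π, Complex.exp (((t * W n π : ℝ) : ℂ) * Complex.I)) atTop
      (𝓝 ((Real.exp (-(v * t ^ 2 / 2)) : ℝ) : ℂ))) : TendstoGauss W v := by
  set P : ℕ → ProbabilityMeasure ℝ := fun n => ⟨permLaw n (W n), inferInstance⟩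
  set G : ProbabilityMeasure ℝ := ⟨ProbabilityTheory.gaussianReal 0 v, inferInstance⟩
  have hP : Tendsto P atTop (𝓝 G) := by
    refine ProbabilityMeasure.tendsto_iff_tendsto_charFun.2 fun t => ?_
    have e1 : charFun (G : Measure ℝ) t = ((Real.exp (-(v * t ^ 2 / 2)) : ℝ) : ℂ) := by
      refine (ProbabilityTheory.charFun_gaussianReal t).trans ?_
      push_cast
      congr 1
      ring
    rw [e1]
    convert h t using 2 with n
    refine (charFun_apply_real t).trans ((integral_permLaw _ _).trans ?_)
    rw [Fintype.expect_eq_sum_div_card, Fintype.card_perm, Fintype.card_fin, div_eq_inv_mul,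
      Complex.real_smul]
    push_cast
    rfl
  intro f
  have hf := ProbabilityMeasure.tendsto_iff_forall_integral_tendsto.1 hP f
  refine hf.congr fun n => ?_
  refine (integral_permLaw _ _).trans ?_
  rw [pexp, div_eq_inv_mul, smul_eq_mul]

theorem tendstoGauss_of_tendsto_charDist {μ : ℝ} {s : NNReal} {b : ℕ → ℝ}
    (h : ∀ t : ℝ, Tendsto (fun n : ℕ => charDist m k μ s (t / Real.sqrt n) n) atTop (𝓝 0))
    (hb : Tendsto (fun n : ℕ => (b n - μ * (n + 1)) / Real.sqrt n) atTop (𝓝 0)) :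
    TendstoGauss (fun n π => (keyCount m k n π - b n) / Real.sqrt n) s := by
  refine tendstoGauss_of_tendsto_expect_exp fun t => ?_
  have h1 : Tendsto (fun n : ℕ => -(s * ((n : ℝ) + 1) * (t / Real.sqrt n) ^ 2 / 2)) atTop
      (𝓝 (-(s * t ^ 2 / 2))) := by
    have h2 : Tendsto (fun n : ℕ => -(s * t ^ 2 / 2) * (1 + 1 / (n : ℝ))) atTop
        (𝓝 (-(s * t ^ 2 / 2) * (1 + 0))) :=
      (tendsto_const_nhds.add tendsto_one_div_atTop_nhds_zero_nat).const_mul _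
    rw [add_zero, mul_one] at h2
    refine h2.congr' ?_
    filter_upwards [eventually_gt_atTop 0] with n hn
    have hn' : (n : ℝ) ≠ 0 := by positivity
    rw [div_pow, Real.sq_sqrt (Nat.cast_nonneg n)]
    field_simp
  have h3 : Tendsto (fun n : ℕ => charCount m k μ (t / Real.sqrt n) n) atTop
      (𝓝 ((Real.exp (-(s * t ^ 2 / 2)) : ℝ) : ℂ)) := by
    have h4 := tendsto_zero_iff_norm_tendsto_zero.2 (h t)
    have h5 := (Complex.continuous_ofReal.tendsto _).comp ((Real.continuous_exp.tendsto _).comp h1)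
    have h6 := h4.add h5
    rw [zero_add] at h6
    refine h6.congr fun n => ?_
    simp [Function.comp_def]
  have h7 : Tendsto (fun n : ℕ => Complex.exp (((-(t * ((b n - μ * (n + 1)) / Real.sqrt n)) : ℝ) :
      ℂ) * Complex.I)) atTop (𝓝 1) := by
    have h8 := ((hb.const_mul t).neg)
    rw [mul_zero, neg_zero] at h8
    have h9 := (((Complex.continuous_ofReal.tendsto _).comp h8).mul_const Complex.I)
    have h10 := (Complex.continuous_exp.tendsto _).comp h9
    simpa [Function.comp_def] using h10
  have h11 := h7.mul h3
  rw [one_mul] at h11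
  refine h11.congr fun n => ?_
  rw [charCount, Finset.mul_expect]
  apply Finset.expect_congr rfl
  intro π _
  rw [← Complex.exp_add]
  congr 1
  push_cast
  ring

theorem abs_div_sqrt_mul_le (t : ℝ) (n : ℕ) :
    |t / Real.sqrt n| * Real.sqrt (n + 1) ≤ 2 * |t| := by
  rcases Nat.eq_zero_or_pos n with rfl | hn
  · simp
  · have hn' : (1 : ℝ) ≤ n := by exact_mod_cast hn
    have h0 : 0 < Real.sqrt n := Real.sqrt_pos.2 (by positivity)
    have h1 : Real.sqrt ((n : ℝ) + 1) ≤ 2 * Real.sqrt n := by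
      rw [Real.sqrt_le_left (by positivity), mul_pow, Real.sq_sqrt (by positivity)]
      linarith
    rw [abs_div, abs_of_pos h0, div_mul_eq_mul_div, div_le_iff₀ h0]
    nlinarith [abs_nonneg t]

theorem tendsto_sub_div_sqrt {f : ℕ → ℝ} {C β : ℝ} (hβ : β < 1 / 2)
    (hf : ∀ n : ℕ, |f n| ≤ C * ((n : ℝ) + 1) ^ β) :
    Tendsto (fun n : ℕ => f n / Real.sqrt n) atTop (𝓝 0) := by
  have hN : Tendsto (fun n : ℕ => (n : ℝ) + 1) atTop atTop :=
    tendsto_atTop_add_const_right _ _ tendsto_natCast_atTop_atTop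
  have hu : Tendsto (fun n : ℕ => 2 * C * ((n : ℝ) + 1) ^ (β - 1 / 2)) atTop (𝓝 0) := by
    have h := (tendsto_rpow_neg_atTop (by linarith : 0 < 1 / 2 - β)).comp hN
    simpa [Function.comp_def] using h.const_mul (2 * C)
  have hC : 0 ≤ C := by simpa using (abs_nonneg _).trans (hf 0)
  refine squeeze_zero_norm (fun n => ?_) hu
  have hn0 : (0 : ℝ) < n + 1 := by positivity
  have hr : 0 < Real.sqrt ((n : ℝ) + 1) := Real.sqrt_pos.2 hn0
  have h1 := abs_div_sqrt_mul_le (f n) n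
  rw [Real.norm_eq_abs]
  have h2 : ((n : ℝ) + 1) ^ (β - 1 / 2) = ((n : ℝ) + 1) ^ β / Real.sqrt (n + 1) := by
    rw [Real.sqrt_eq_rpow, Real.rpow_sub hn0]
  rw [h2, ← mul_div_assoc, le_div_iff₀ hr]
  linarith [hf n]

theorem exists_tendsto_charDist (k : ℕ) (hm : 2 ≤ m) (hm' : m ≤ 26) :
    ∃ s : NNReal, (¬ (k = 0 ∧ m = 2) → 0 < s) ∧
      (∀ t : ℝ, Tendsto (fun n : ℕ => charDist m k (countDensity m k) s (t / Real.sqrt n) n)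
        atTop (𝓝 0)) ∧
      Tendsto (fun n : ℕ => (meanCount m k n - countDensity m k * (n + 1)) / Real.sqrt n)
        atTop (𝓝 0) := by
  obtain ⟨β, h0, h1, hroots⟩ := exists_root_bound hm hm'
  obtain ⟨C, hC⟩ := abs_meanCount_sub_le (k := k) hm h0 (by linarith) hroots
  have hbias := fun n hn c hc => abs_splitBias_le (k := k) (n := n) (c := c) hm h0 hC hn hc
  obtain ⟨s, hs, hpos, D, hD⟩ := exists_variance (k := k) hm h0 h1 hroots hbias
  have hE := momentCount_two_le (m := m) (k := k) h1 hD
  obtain ⟨K, hK0, hK⟩ := exists_momentCount_four_le (k := k) hm h1 hbias hE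
  have hC0 : 0 ≤ C := by simpa using (abs_nonneg _).trans (hC 0)
  have hD0 : 0 ≤ D := by simpa using (abs_nonneg _).trans (hD 0)
  exact ⟨⟨s, hs⟩, hpos, fun t => tendsto_charDist hm h0 h1 hs hC0 hD0 (add_nonneg hs hD0) hK0 hC hD
    hE hK (abs_div_sqrt_mul_le t), tendsto_sub_div_sqrt h1 hC⟩

end

end

/-- **Theorem (fringe subtrees with `k` keys in random `m`-ary search trees).**
Assume `2 ≤ m ≤ 26` and let `k ≥ 0` be fixed. Let `Y_{n,k}` be the number of fringe
subtrees with exactly `k` keys in the random `m`-ary search tree with `n` keys. Then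
`n^{-1/2}(Y_{n,k} - E Y_{n,k})` converges in distribution to `N(0, σ_k²)`, where
`σ_k² > 0` except when `k = 0` and `m = 2`; moreover
`n^{-1/2}(Y_{n,k} - n/((H_m - 1)(k+1)(k+2)))` converges to the same limit. -/
theorem fringe_count_keys_clt (m k : ℕ) (hm : 2 ≤ m) (hm' : m ≤ 26) :
    ∃ σ2 : NNReal,
      (¬ (k = 0 ∧ m = 2) → 0 < σ2) ∧
      TendstoGauss (fun n π =>
        ((countKeys k (mst m n π) : ℝ)
            - pexp n (fun π' => (countKeys k (mst m n π') : ℝ))) / Real.sqrt n) σ2 ∧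
      TendstoGauss (fun n π =>
        ((countKeys k (mst m n π) : ℝ)
            - (n : ℝ) / ((Hm m - 1) * ((k : ℝ) + 1) * ((k : ℝ) + 2))) / Real.sqrt n) σ2 := by
  obtain ⟨s, hpos, h, hmean⟩ := exists_tendsto_charDist k hm hm'
  refine ⟨s, hpos, ?_, ?_⟩
  · have hW := tendstoGauss_of_tendsto_charDist h hmean
    convert hW using 4 with n π
    exact congrArg _ (pexp_eq_expect _)
  · refine tendstoGauss_of_tendsto_charDist h (tendsto_sub_div_sqrt (C := |countDensity m k|)
      (β := 0) (by norm_num) fun n => ?_)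
    rw [Real.rpow_zero, mul_one, ← abs_neg]
    refine le_of_eq (congrArg _ ?_)
    rw [countDensity]
    ring

end MSTpaper
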